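/- Let K be a centered convex body in ℝ³ whose radial function ρ_K is C^∞ on S². Then K is the intersection body of some star body; equivalently, there exists a nonnegative continuous even function g on S² such that ρ_K(u) = ∫_{S² ∩ u^⊥} g(v) dλ₁(v) for every u ∈ S². -/

import Mathlib

open MeasureTheory Metric
open scoped RealInnerProductSpace ENNReal

noncomputable section

abbrev E (n : ℕ) := EuclideanSpace ℝ (Fin n)

/-- The radial function of a set: `ρ_K(x) = max {c ≥ 0 : c • x ∈ K}`. -/
def radialFn {n : ℕ} (K : Set (E n)) (x : E n) : ℝ :=
  sSup {c : ℝ | 0 ≤ c ∧ c • x ∈ K}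

/-- A convex body: compact convex set with nonempty interior. -/
def IsConvexBody {n : ℕ} (K : Set (E n)) : Prop :=
  IsCompact K ∧ Convex ℝ K ∧ (interior K).Nonempty

/-- Centered: symmetric about the origin. -/
def IsCentered {n : ℕ} (K : Set (E n)) : Prop :=
  ∀ x, x ∈ K ↔ -x ∈ K

/-- The hyperplane through the origin orthogonal to `u`. -/
def hyperplane {n : ℕ} (u : E n) : Set (E n) := {x | ⟪x, u⟫ = 0}

/-- A star body: compact, star-shaped at the origin (contains the origin), with
continuous radial function on the unit sphere. -/
def IsStarBody {n : ℕ} (L : Set (E n)) : Prop :=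
  IsCompact L ∧ (0 : E n) ∈ L ∧ StarConvex ℝ 0 L ∧
    ContinuousOn (radialFn L) (sphere (0 : E n) 1)

/-- `L` is the intersection body of `M`: `ρ_L(u) = λ_{n-1}(M ∩ u^⊥)` for `u ∈ S^{n-1}`. -/
def IsIntersectionBodyOf {n : ℕ} (L M : Set (E n)) : Prop :=
  ∀ u ∈ sphere (0 : E n) 1,
    radialFn L u = (μH[(n : ℝ) - 1] (M ∩ hyperplane u)).toReal

/-- The spherical Radon transform:
`(Rg)(u) = ∫_{S^{n-1} ∩ u^⊥} g dλ_{n-2}`. -/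
def radon (n : ℕ) (g : E n → ℝ) (u : E n) : ℝ :=
  ∫ v in (sphere (0 : E n) 1 ∩ hyperplane u), g v ∂μH[(n : ℝ) - 2]

/-- A function on the sphere is C^∞ if its 0-homogeneous extension is smooth
away from the origin. -/
def SmoothOnSphere {n : ℕ} (h : E n → ℝ) : Prop :=
  ContDiffOn ℝ (⊤ : ℕ∞) (fun x : E n => h (‖x‖⁻¹ • x)) {(0 : E n)}ᶜ

/-- A body of revolution about the axis `u₀`: invariant under every (linear)
isometry of `ℝⁿ` fixing `u₀`. -/
def IsRevolutionBody {n : ℕ} (u₀ : E n) (K : Set (E n)) : Prop :=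
  ∀ f : E n ≃ₗᵢ[ℝ] E n, f u₀ = u₀ → f '' K = K

section Auxiliary

open Real Set Filter Topology

theorem lt_volume_of_half_sub_mem {A B D : Set ℝ} {t : ℝ≥0∞} (hA : MeasurableSet A)
    (hB : MeasurableSet B) (htA : t < volume A) (htB : t < volume B)
    (h : ∀ a ∈ A, ∀ b ∈ B, (a - b) / 2 ∈ D) : t < volume D := by
  obtain ⟨A', hA', cA, tA⟩ := hA.exists_lt_isCompact htA
  obtain ⟨B', hB', cB, tB⟩ := hB.exists_lt_isCompact htB
  have nA : A'.Nonempty := nonempty_of_measure_ne_zero (ne_bot_of_gt tA)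
  have nB : B'.Nonempty := nonempty_of_measure_ne_zero (ne_bot_of_gt tB)
  obtain ⟨M, hM, hM'⟩ := cA.exists_isGreatest nA
  obtain ⟨m, hm, hm'⟩ := cB.exists_isGreatest nB
  set P : Set ℝ := (fun x => 2 * x + m) ⁻¹' A' with hP
  set Q : Set ℝ := (fun x => -2 * x + M) ⁻¹' B' with hQ
  have vP : volume P = ENNReal.ofReal (1 / 2) * volume A' := by
    have : P = (fun x => (2 : ℝ) * x) ⁻¹' ((fun x => x + m) ⁻¹' A') := rfl
    rw [this, Real.volume_preimage_mul_left two_ne_zero, measure_preimage_add_right]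
    norm_num
  have vQ : volume Q = ENNReal.ofReal (1 / 2) * volume B' := by
    have : Q = (fun x => (-2 : ℝ) * x) ⁻¹' ((fun x => x + M) ⁻¹' B') := rfl
    rw [this, Real.volume_preimage_mul_left (by norm_num), measure_preimage_add_right]
    norm_num
  have mQ : MeasurableSet Q := cB.measurableSet.preimage (by fun_prop)
  have hPD : P ∪ Q ⊆ D := by
    rintro x (hx | hx)
    · have := h _ (hA' hx) m (hB' hm)
      simpa using this
    · have := h M (hA' hM) _ (hB' hx)
      convert this using 1
      ring
  have hPQ : volume (P ∩ Q) = 0 := by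
    refine measure_mono_null (t := {(M - m) / 2}) ?_ (by simp)
    rintro x ⟨h1, h2⟩
    have h1' := hM' h1
    have h2' := hm' h2
    simp only [Set.mem_singleton_iff]
    linarith
  have hsum := measure_union_add_inter (μ := volume) P mQ
  rw [hPQ, add_zero, vP, vQ] at hsum
  refine lt_of_lt_of_le ?_ (measure_mono hPD)
  rw [hsum, ← mul_add]
  have tt : t + t < volume A' + volume B' := ENNReal.add_lt_add tA tB
  have ht : t = ENNReal.ofReal (1 / 2) * (t + t) := by
    rw [← two_mul, ← mul_assoc]
    have : ENNReal.ofReal (1 / 2) * 2 = 1 := by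
      rw [← ENNReal.ofReal_ofNat, ← ENNReal.ofReal_mul (by norm_num)]; norm_num
    rw [this, one_mul]
  conv_lhs => rw [ht]
  exact (ENNReal.mul_lt_mul_iff_right (by simp) (by simp)).2 tt

theorem lintegral_ofReal_le_of_meas_lt {α : Type*} [MeasurableSpace α] {μ : Measure α}
    {F G : α → ℝ} (hF : Measurable F) (hG : Measurable G) (hF0 : 0 ≤ F) (hG0 : 0 ≤ G)
    (h : ∀ t : ℝ, 0 < t → μ {x | t < F x} ≤ μ {x | t < G x}) :
    ∫⁻ x, ENNReal.ofReal (F x) ∂μ ≤ ∫⁻ x, ENNReal.ofReal (G x) ∂μ := by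
  rw [lintegral_eq_lintegral_meas_lt μ (.of_forall hF0) hF.aemeasurable,
    lintegral_eq_lintegral_meas_lt μ (.of_forall hG0) hG.aemeasurable]
  exact setLIntegral_mono' measurableSet_Ioi fun t ht => h t ht

theorem volume_le_of_half_sub_mem {S D : Set (ℝ × ℝ)} (hS : MeasurableSet S)
    (hD : MeasurableSet D) (bS : Bornology.IsBounded S) (bD : Bornology.IsBounded D)
    (h : ∀ p ∈ S, ∀ q ∈ S, (2⁻¹ : ℝ) • (p - q) ∈ D) : volume S ≤ volume D := by
  have fin : ∀ {T : Set (ℝ × ℝ)}, Bornology.IsBounded T → ∀ x, volume (Prod.mk x ⁻¹' T) ≠ ∞ := by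
    intro T hT x
    refine ne_top_of_le_ne_top ?_ (measure_mono (?_ : _ ⊆ Prod.snd '' T))
    · exact (hT.image_snd).measure_lt_top.ne
    · rintro y hy
      exact ⟨_, hy, rfl⟩
  have key : ∀ {T : Set (ℝ × ℝ)}, MeasurableSet T → Bornology.IsBounded T →
      volume T = ∫⁻ x, ENNReal.ofReal (volume (Prod.mk x ⁻¹' T)).toReal := by
    intro T hT bT
    rw [Measure.volume_eq_prod, Measure.prod_apply hT]
    refine lintegral_congr fun x => ?_
    rw [ENNReal.ofReal_toReal (fin bT x)]
  rw [key hS bS, key hD bD]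
  have meas : ∀ {T : Set (ℝ × ℝ)}, MeasurableSet T →
      Measurable fun x => (volume (Prod.mk x ⁻¹' T)).toReal :=
    fun hT => (measurable_measure_prodMk_left hT).ennreal_toReal
  refine lintegral_ofReal_le_of_meas_lt (meas hS) (meas hD) (fun _ => ENNReal.toReal_nonneg)
    (fun _ => ENNReal.toReal_nonneg) fun t ht => ?_
  refine le_of_forall_lt fun s hs => ?_
  have mI : MeasurableSet {x | t < (volume (Prod.mk x ⁻¹' S)).toReal} :=
    measurableSet_lt measurable_const (meas hS)
  refine lt_volume_of_half_sub_mem mI mI hs hs ?_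
  intro a ha b hb
  simp only [Set.mem_ofPred_eq] at ha hb ⊢
  rw [← ENNReal.ofReal_lt_iff_lt_toReal ht.le (fin bS _)] at ha hb
  rw [← ENNReal.ofReal_lt_iff_lt_toReal ht.le (fin bD _)]
  refine lt_volume_of_half_sub_mem (measurable_prodMk_left hS) (measurable_prodMk_left hS) ha hb ?_
  intro y hy y' hy'
  have := h _ hy _ hy'
  simp only [Set.mem_preimage]
  convert this using 1
  ext <;> simp <;> ring

/-- A function version of the fact that central sections of symmetric convex bodies are maximal. -/
theorem integral_le_integral_of_half_sub {F G : ℝ × ℝ → ℝ} (hF : Continuous F) (hG : Continuous G)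
    (sF : HasCompactSupport F) (sG : HasCompactSupport G) (hF0 : 0 ≤ F) (hG0 : 0 ≤ G)
    (h : ∀ p q, min (F p) (F q) ≤ G ((2⁻¹ : ℝ) • (p - q))) : ∫ p, F p ≤ ∫ p, G p := by
  rw [integral_eq_lintegral_of_nonneg_ae (.of_forall hF0) hF.aestronglyMeasurable,
    integral_eq_lintegral_of_nonneg_ae (.of_forall hG0) hG.aestronglyMeasurable]
  have bdd : ∀ {H : ℝ × ℝ → ℝ}, HasCompactSupport H → ∀ t : ℝ, 0 < t →
      Bornology.IsBounded {p | t < H p} := by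
    intro H hH t ht
    refine hH.isCompact.isBounded.subset fun p hp => subset_closure ?_
    exact (ht.trans hp).ne'
  refine ENNReal.toReal_mono ?_ (lintegral_ofReal_le_of_meas_lt hF.measurable hG.measurable hF0 hG0
    fun t ht => volume_le_of_half_sub_mem (measurableSet_lt measurable_const hF.measurable)
      (measurableSet_lt measurable_const hG.measurable) (bdd sF t ht) (bdd sG t ht) ?_)
  · exact (hG.integrable_of_hasCompactSupport sG).lintegral_lt_top.ne
  · intro p hp q hq
    exact (lt_min hp hq).trans_le (h p q)

theorem measurePreserving_prod_linear {α β γ δ : ℝ} (h : |α * δ - β * γ| = 1) :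
    MeasurePreserving (fun p : ℝ × ℝ => (α * p.1 + β * p.2, γ * p.1 + δ * p.2)) := by
  set L := Matrix.toLin (Module.Basis.finTwoProd ℝ) (Module.Basis.finTwoProd ℝ) !![α, β; γ, δ] with hL
  have hd : LinearMap.det L = α * δ - β * γ := by
    rw [hL, LinearMap.det_toLin, Matrix.det_fin_two_of]
  have hL' : (L : ℝ × ℝ → ℝ × ℝ) = fun p => (α * p.1 + β * p.2, γ * p.1 + δ * p.2) := by
    ext p <;> rw [hL, Matrix.toLin_finTwoProd_apply]
  have hne : LinearMap.det L ≠ 0 := by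
    rw [hd]; intro h0; rw [h0] at h; simp at h
  have := Measure.map_linearMap_addHaar_eq_smul_addHaar (volume : Measure (ℝ × ℝ)) hne
  refine ⟨by fun_prop, ?_⟩
  rw [← hL', this, hd, abs_inv, h]
  simp

theorem integral_comp_prod_linear {α β γ δ : ℝ} (h : |α * δ - β * γ| = 1) (F : ℝ × ℝ → ℝ) :
    ∫ p : ℝ × ℝ, F (α * p.1 + β * p.2, γ * p.1 + δ * p.2) = ∫ p, F p := by
  refine (measurePreserving_prod_linear h).integral_comp ?_ F
  refine Measurable.measurableEmbedding (by fun_prop) ?_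
  have hne : α * δ - β * γ ≠ 0 := by intro h0; rw [h0] at h; simp at h
  rintro ⟨a, b⟩ ⟨c, d⟩ hp
  simp only [Prod.mk.injEq] at hp ⊢
  obtain ⟨h1, h2⟩ := hp
  constructor
  · apply mul_left_cancel₀ hne; linear_combination δ * h1 - β * h2
  · apply mul_left_cancel₀ hne; linear_combination -γ * h1 + α * h2

/-- The weight `z⁻²` truncated to `z > ε`. -/
def truncInvSq (ε z : ℝ) : ℝ := (Ioi ε).indicator (fun z => (z ^ 2)⁻¹) z

theorem measurable_truncInvSq (ε : ℝ) : Measurable (truncInvSq ε) :=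
  Measurable.indicator (by fun_prop) measurableSet_Ioi

theorem truncInvSq_nonneg (ε z : ℝ) : 0 ≤ truncInvSq ε z :=
  indicator_nonneg (fun _ _ => by positivity) _

theorem truncInvSq_le {ε : ℝ} (hε : 0 < ε) (z : ℝ) : truncInvSq ε z ≤ (ε ^ 2)⁻¹ := by
  rw [truncInvSq]
  by_cases hz : z ∈ Ioi ε
  · rw [indicator_of_mem hz]
    have : ε < z := hz
    gcongr
  · rw [indicator_of_notMem hz]
    positivity

theorem integrableOn_inv_sq {ε : ℝ} (hε : 0 < ε) :
    IntegrableOn (fun z : ℝ => (z ^ 2)⁻¹) (Ioi ε) := by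
  have := integrableOn_Ioi_rpow_of_lt (a := -2) (by norm_num) hε
  refine this.congr_fun (fun z hz => ?_) measurableSet_Ioi
  have hz' : 0 < z := hε.trans hz
  simp only
  rw [rpow_neg hz'.le]; norm_cast

theorem integrable_truncInvSq {ε : ℝ} (hε : 0 < ε) : Integrable (truncInvSq ε) :=
  (integrable_indicator_iff measurableSet_Ioi).2 (integrableOn_inv_sq hε)

theorem integral_truncInvSq {ε : ℝ} (hε : 0 < ε) : ∫ z, truncInvSq ε z = ε⁻¹ := by
  have h1 : ∫ z, truncInvSq ε z = ∫ z in Ioi ε, (z ^ 2)⁻¹ := integral_indicator measurableSet_Ioi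
  have := integral_Ioi_rpow_of_lt (a := -2) (by norm_num) hε
  rw [h1, setIntegral_congr_fun (g := fun z : ℝ => z ^ (-2 : ℝ)) measurableSet_Ioi, this]
  · norm_num [rpow_neg hε.le]
  · intro z hz
    have hz' : 0 < z := hε.trans hz
    simp only
    rw [rpow_neg hz'.le]; norm_cast

theorem integral_truncInvSq_cos {ε r : ℝ} (hε : 0 < ε) (hr : 0 < r) :
    ∫ θ in (-π)..π, truncInvSq ε (r * cos θ) = 2 / (ε * r) * √(1 - (ε / r) ^ 2) := by
  rcases le_or_gt r ε with h | h
  · have h1 : ∀ θ, truncInvSq ε (r * cos θ) = 0 := by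
      intro θ
      refine indicator_of_notMem ?_ _
      simp only [mem_Ioi, not_lt]
      nlinarith [cos_le_one θ]
    have : 1 ≤ ε / r := (one_le_div hr).2 h
    rw [sqrt_eq_zero_of_nonpos (by nlinarith)]
    simp [h1]
  · set α := arccos (ε / r) with hα
    have hq0 : 0 < ε / r := by positivity
    have hq1 : ε / r < 1 := (div_lt_one hr).2 h
    have hcα : cos α = ε / r := cos_arccos (by linarith) hq1.le
    have hα0 : 0 < α := arccos_pos.2 hq1
    have hα1 : α < π / 2 := arccos_lt_pi_div_two.2 hq0
    have hmem : ∀ θ ∈ Ioc (-π) π, (r * cos θ ∈ Ioi ε ↔ θ ∈ Ioo (-α) α) := by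
      intro θ hθ
      rw [mem_Ioi, mem_Ioo, ← abs_lt, ← cos_abs θ, ← div_lt_iff₀' hr, ← hcα]
      refine strictAntiOn_cos.lt_iff_gt ⟨hα0.le, by linarith [pi_pos]⟩ ⟨abs_nonneg _, ?_⟩
      exact abs_le.2 ⟨hθ.1.le, hθ.2⟩
    have e1 : ∫ θ in (-π)..π, truncInvSq ε (r * cos θ) =
        ∫ θ in (-α)..α, (r ^ 2)⁻¹ * (1 / cos θ ^ 2) := by
      rw [intervalIntegral.integral_of_le (by linarith [pi_pos]),
        intervalIntegral.integral_of_le (by linarith), ← integral_indicator measurableSet_Ioc,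
        integral_Ioc_eq_integral_Ioo, ← integral_indicator measurableSet_Ioo]
      congr 1
      ext θ
      by_cases hθ : θ ∈ Ioc (-π) π
      · rw [indicator_of_mem hθ]
        by_cases hθ' : θ ∈ Ioo (-α) α
        · rw [truncInvSq, indicator_of_mem hθ', indicator_of_mem ((hmem θ hθ).2 hθ'), mul_pow,
            mul_inv, one_div]
        · rw [truncInvSq, indicator_of_notMem hθ',
            indicator_of_notMem (fun hh => hθ' ((hmem θ hθ).1 hh))]
      · rw [indicator_of_notMem hθ, indicator_of_notMem]
        intro hh
        exact hθ ⟨by linarith [hh.1, pi_pos], by linarith [hh.2, pi_pos]⟩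
    have hcos : ∀ θ ∈ uIcc (-α) α, 0 < cos θ := by
      intro θ hθ
      rw [uIcc_of_le (by linarith)] at hθ
      exact cos_pos_of_mem_Ioo ⟨by linarith [hθ.1], by linarith [hθ.2]⟩
    rw [e1, intervalIntegral.integral_const_mul,
      intervalIntegral.integral_eq_sub_of_hasDerivAt (f := tan)
        (fun θ hθ => hasDerivAt_tan (hcos θ hθ).ne')]
    · rw [tan_neg, hα, tan_arccos]
      field_simp
      ring
    · refine ContinuousOn.intervalIntegrable fun θ hθ => ?_
      refine ContinuousAt.continuousWithinAt ?_
      have := (hcos θ hθ).ne'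
      fun_prop (disch := simpa)

/-- Euclidean length of a pair. -/
def pairNorm (x : ℝ × ℝ) : ℝ := √(x.1 ^ 2 + x.2 ^ 2)

theorem integral_truncInvSq_rotate {ε : ℝ} (hε : 0 < ε) (x : ℝ × ℝ) :
    ∫ θ in (-π)..π, truncInvSq ε (x.1 * cos θ + x.2 * sin θ) =
      2 / (ε * pairNorm x) * √(1 - (ε / pairNorm x) ^ 2) := by
  set w : ℂ := ⟨x.1, x.2⟩ with hw
  have hn : ‖w‖ = pairNorm x := by
    rw [Complex.norm_eq_sqrt_sq_add_sq, pairNorm]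
  rcases eq_or_ne w 0 with h0 | h0
  · have h1 : x.1 = 0 := congrArg Complex.re h0
    have h2 : x.2 = 0 := congrArg Complex.im h0
    have h3 : truncInvSq ε 0 = 0 := indicator_of_notMem (by simpa using hε.le) _
    simp [h1, h2, pairNorm, h3]
  · rw [← hn, ← integral_truncInvSq_cos hε (norm_pos_iff.2 h0)]
    have h1 : ‖w‖ * cos w.arg = x.1 := Complex.norm_mul_cos_arg w
    have h2 : ‖w‖ * sin w.arg = x.2 := Complex.norm_mul_sin_arg w
    have h3 : ∀ θ, x.1 * cos θ + x.2 * sin θ = ‖w‖ * cos (θ - w.arg) := by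
      intro θ; rw [← h1, ← h2, cos_sub]; ring
    simp_rw [h3]
    rw [intervalIntegral.integral_comp_sub_right (fun θ => truncInvSq ε (‖w‖ * cos θ))]
    have hp : Function.Periodic (fun θ => truncInvSq ε (‖w‖ * cos θ)) (2 * π) := by
      intro θ; simp
    have := hp.intervalIntegral_add_eq (-π - w.arg) (-π)
    convert this using 2 <;> ring

/-- The integral of `h` over the line at signed distance `z` from the origin with normal
direction `θ`. -/
def lineInt (h : ℝ × ℝ → ℝ) (θ z : ℝ) : ℝ :=
  ∫ t, h (z * cos θ - t * sin θ, z * sin θ + t * cos θ)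

theorem exists_radius {h : ℝ × ℝ → ℝ} (hs : HasCompactSupport h) :
    ∃ R : ℝ, 0 < R ∧ ∀ x : ℝ × ℝ, R ^ 2 < x.1 ^ 2 + x.2 ^ 2 → h x = 0 := by
  obtain ⟨R, hR⟩ := hs.isCompact.isBounded.exists_norm_le
  refine ⟨2 * (|R| + 1), by positivity, fun x hx => ?_⟩
  by_contra hne
  have h1 := hR x (subset_closure hne)
  rw [Prod.norm_def, max_le_iff, norm_eq_abs, norm_eq_abs] at h1
  have h2 := h1.1.trans (le_abs_self R)
  have h3 := h1.2.trans (le_abs_self R)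
  have := sq_abs x.1
  have := sq_abs x.2
  nlinarith [abs_nonneg x.1, abs_nonneg x.2, abs_nonneg R]

theorem continuous_lineInt {h : ℝ × ℝ → ℝ} (hc : Continuous h) (hs : HasCompactSupport h) :
    Continuous (Function.uncurry (lineInt h)) := by
  obtain ⟨R, hR, hR'⟩ := exists_radius hs
  have : Function.uncurry (lineInt h) = fun q : ℝ × ℝ =>
      ∫ t in Icc (-R) R, h (q.2 * cos q.1 - t * sin q.1, q.2 * sin q.1 + t * cos q.1) := by
    ext ⟨θ, z⟩
    refine (setIntegral_eq_integral_of_forall_compl_eq_zero fun t ht => hR' _ ?_).symm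
    have h1 : R < |t| := by
      rw [mem_Icc, ← abs_le] at ht; exact not_le.1 ht
    have h2 : R ^ 2 < t ^ 2 := by rw [← sq_abs t]; gcongr
    have h3 := sin_sq_add_cos_sq θ
    simp only
    nlinarith [sq_nonneg z, sq_nonneg t]
  rw [this]
  exact continuous_parametric_integral_of_continuous (by fun_prop) isCompact_Icc

theorem pairNorm_polar {r : ℝ} (hr : 0 ≤ r) (φ : ℝ) : pairNorm (r * cos φ, r * sin φ) = r := by
  rw [pairNorm]
  simp only
  rw [mul_pow, mul_pow, ← mul_add, cos_sq_add_sin_sq, mul_one, sqrt_sq hr]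

theorem integrableOn_polar {h : ℝ × ℝ → ℝ} (hs : HasCompactSupport h) (hc : Continuous h) :
    IntegrableOn (fun p : ℝ × ℝ => 2 * h (p.1 * cos p.2, p.1 * sin p.2))
      (Ioi 0 ×ˢ Ioo (-π) π) := by
  obtain ⟨R, hR, hR'⟩ := exists_radius hs
  have hcpt : IsCompact (Icc 0 R ×ˢ Icc (-π) π) := isCompact_Icc.prod isCompact_Icc
  have h2 : IntegrableOn (fun p : ℝ × ℝ => 2 * h (p.1 * cos p.2, p.1 * sin p.2))
    (Icc 0 R ×ˢ Icc (-π) π) := ContinuousOn.integrableOn_compact hcpt (by fun_prop)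
  refine h2.of_forall_sdiff_eq_zero (measurableSet_Ioi.prod measurableSet_Ioo) ?_
  rintro ⟨r, φ⟩ ⟨⟨h3, h4⟩, h5⟩
  rw [hR', mul_zero]
  have : R < r := by
    by_contra h6
    exact h5 ⟨⟨le_of_lt h3, not_lt.1 h6⟩, Ioo_subset_Icc_self h4⟩
  simp only
  rw [mul_pow, mul_pow, ← mul_add, cos_sq_add_sin_sq, mul_one]
  gcongr

theorem integrable_div_pairNorm {h : ℝ × ℝ → ℝ} (hs : HasCompactSupport h) (hc : Continuous h) :
    Integrable fun x => 2 / pairNorm x * h x := by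
  have hm : Measurable pairNorm := by unfold pairNorm; fun_prop
  refine ⟨((hm.const_div 2).mul hc.measurable).aestronglyMeasurable, ?_⟩
  rw [HasFiniteIntegral, ← lintegral_comp_polarCoord_symm, polarCoord_target]
  refine lt_of_le_of_lt ?_ (integrableOn_polar hs hc).2
  refine setLIntegral_mono' (measurableSet_Ioi.prod measurableSet_Ioo) ?_
  rintro ⟨r, φ⟩ ⟨hr, -⟩
  have hr' : 0 < r := hr
  simp only [polarCoord_symm_apply, smul_eq_mul]
  rw [pairNorm_polar hr'.le, ← enorm_of_nonneg hr'.le, ← enorm_mul]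
  refine le_of_eq (congrArg _ ?_)
  field_simp

theorem integral_lineInt_zero {h : ℝ × ℝ → ℝ} (hs : HasCompactSupport h) (hc : Continuous h)
    (he : ∀ x, h (-x) = h x) :
    ∫ θ in (-π)..π, lineInt h θ 0 = ∫ x, 2 / pairNorm x * h x := by
  set H : ℝ → ℝ := fun φ => ∫ r in Ioi (0 : ℝ), h (r * cos φ, r * sin φ) with hH
  have h1 : ∀ θ, lineInt h θ 0 = 2 * H (θ + π / 2) := by
    intro θ
    rw [hH]
    simp only
    rw [← integral_comp_abs (f := fun r => h (r * cos (θ + π / 2), r * sin (θ + π / 2))), lineInt]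
    congr 1
    ext t
    rw [cos_add_pi_div_two, sin_add_pi_div_two]
    rcases abs_choice t with ht | ht
    · rw [ht]; congr 1; ext <;> simp
    · rw [ht, ← he]; congr 1; ext <;> simp
  have hp : Function.Periodic H (2 * π) := by intro φ; simp [hH]
  simp_rw [h1]
  rw [intervalIntegral.integral_const_mul, intervalIntegral.integral_comp_add_right]
  have := hp.intervalIntegral_add_eq (-π + π / 2) (-π)
  have e : -π + π / 2 + 2 * π = π + π / 2 := by ring
  have e' : -π + 2 * π = π := by ring
  rw [e, e'] at this
  rw [this, ← integral_comp_polarCoord_symm, polarCoord_target,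
    intervalIntegral.integral_of_le (by linarith [pi_pos]), integral_Ioc_eq_integral_Ioo,
    ← integral_const_mul]
  have hint := integrableOn_polar hs hc
  have e2 : ∫ p in Ioi 0 ×ˢ Ioo (-π) π, p.1 • (2 / pairNorm (polarCoord.symm p) *
      h (polarCoord.symm p)) =
      ∫ p in Ioi 0 ×ˢ Ioo (-π) π, 2 * h (p.1 * cos p.2, p.1 * sin p.2) := by
    refine setIntegral_congr_fun (measurableSet_Ioi.prod measurableSet_Ioo) ?_
    rintro ⟨r, φ⟩ ⟨hr, -⟩
    have hr' : 0 < r := hr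
    simp only [polarCoord_symm_apply, smul_eq_mul]
    rw [pairNorm_polar hr'.le]
    field_simp
  rw [e2, Measure.volume_eq_prod, ← Measure.prod_restrict, integral_prod_symm]
  · refine integral_congr_ae (.of_forall fun φ => ?_)
    simp only [hH]
    rw [integral_const_mul]
  · rwa [Measure.prod_restrict]

theorem integral_trunc_lineInt {h : ℝ × ℝ → ℝ} (hc : Continuous h) (hs : HasCompactSupport h)
    {ε : ℝ} (hε : 0 < ε) (θ : ℝ) :
    Integrable (fun z => truncInvSq ε z * lineInt h θ z) ∧
    ∫ z, truncInvSq ε z * lineInt h θ z =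
      ∫ x : ℝ × ℝ, truncInvSq ε (x.1 * cos θ + x.2 * sin θ) * h x := by
  set F : ℝ × ℝ → ℝ := fun x => truncInvSq ε (x.1 * cos θ + x.2 * sin θ) * h x with hF
  have hdet : |cos θ * cos θ - -sin θ * sin θ| = 1 := by
    have : cos θ * cos θ - -sin θ * sin θ = 1 := by linear_combination cos_sq_add_sin_sq θ
    rw [this, abs_one]
  have e1 : ∀ p : ℝ × ℝ, F (cos θ * p.1 + -sin θ * p.2, sin θ * p.1 + cos θ * p.2) =
      truncInvSq ε p.1 * h (p.1 * cos θ - p.2 * sin θ, p.1 * sin θ + p.2 * cos θ) := by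
    intro p
    simp only [hF]
    congr 2
    · linear_combination p.1 * cos_sq_add_sin_sq θ
    · ext <;> simp <;> ring
  have hFi : Integrable F := by
    refine (hc.integrable_of_hasCompactSupport hs).bdd_mul (c := (ε ^ 2)⁻¹) ?_ ?_
    · exact ((measurable_truncInvSq ε).comp (by fun_prop)).aestronglyMeasurable
    · refine .of_forall fun x => ?_
      rw [norm_eq_abs, abs_of_nonneg (truncInvSq_nonneg _ _)]
      exact truncInvSq_le hε _
  have hFi' := (measurePreserving_prod_linear hdet).integrable_comp_of_integrable hFi
  have hFi'' : Integrable (fun p : ℝ × ℝ => truncInvSq ε p.1 *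
      h (p.1 * cos θ - p.2 * sin θ, p.1 * sin θ + p.2 * cos θ)) := by
    refine hFi'.congr (.of_forall fun p => ?_)
    exact e1 p
  have e2 : ∀ z, ∫ t, truncInvSq ε z * h (z * cos θ - t * sin θ, z * sin θ + t * cos θ) =
      truncInvSq ε z * lineInt h θ z := fun z => integral_const_mul _ _
  rw [Measure.volume_eq_prod] at hFi''
  constructor
  · simpa only [e2] using hFi''.integral_prod_left
  · rw [← integral_comp_prod_linear hdet F]
    simp_rw [e1]
    rw [Measure.volume_eq_prod, integral_prod _ hFi'']
    simp_rw [e2]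

theorem integral_integral_trunc_lineInt {h : ℝ × ℝ → ℝ} (hc : Continuous h)
    (hs : HasCompactSupport h) {ε : ℝ} (hε : 0 < ε) :
    IntervalIntegrable (fun θ => ∫ z, truncInvSq ε z * lineInt h θ z) volume (-π) π ∧
    Integrable (fun x => 2 / (ε * pairNorm x) * √(1 - (ε / pairNorm x) ^ 2) * h x) ∧
    ∫ θ in (-π)..π, ∫ z, truncInvSq ε z * lineInt h θ z =
      ∫ x, 2 / (ε * pairNorm x) * √(1 - (ε / pairNorm x) ^ 2) * h x := by
  set μ := (volume : Measure ℝ).restrict (Ioc (-π) π)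
  set G : ℝ × (ℝ × ℝ) → ℝ := fun q =>
    truncInvSq ε (q.2.1 * cos q.1 + q.2.2 * sin q.1) * h q.2 with hG
  have hGi : Integrable G (μ.prod volume) := by
    have : Integrable (fun q : ℝ × (ℝ × ℝ) => h q.2) (μ.prod volume) :=
      (hc.integrable_of_hasCompactSupport hs).comp_snd μ
    refine this.bdd_mul (c := (ε ^ 2)⁻¹) ?_ ?_
    · exact ((measurable_truncInvSq ε).comp (by fun_prop)).aestronglyMeasurable
    · refine .of_forall fun x => ?_
      rw [norm_eq_abs, abs_of_nonneg (truncInvSq_nonneg _ _)]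
      exact truncInvSq_le hε _
  have hle : -π ≤ π := by linarith [pi_pos]
  have e1 : ∀ x : ℝ × ℝ, ∫ θ, G (θ, x) ∂μ =
      2 / (ε * pairNorm x) * √(1 - (ε / pairNorm x) ^ 2) * h x := by
    intro x
    rw [← integral_truncInvSq_rotate hε, intervalIntegral.integral_of_le hle,
      ← integral_mul_const]
  simp_rw [fun θ => (integral_trunc_lineInt hc hs hε θ).2, ← e1]
  refine ⟨?_, hGi.integral_prod_right, ?_⟩
  · rw [intervalIntegrable_iff_integrableOn_Ioc_of_le hle]
    exact hGi.integral_prod_left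
  · rw [intervalIntegral.integral_of_le hle]
    exact integral_integral_swap hGi

/-- The profile of the approximate identity arising in the inversion formula. -/
def invKernel (x : ℝ × ℝ) : ℝ := 2 / pairNorm x * (1 - √(1 - (1 / pairNorm x) ^ 2))

theorem measurable_invKernel : Measurable invKernel := by
  unfold invKernel pairNorm
  fun_prop

theorem one_sub_sqrt_nonneg (r : ℝ) : 0 ≤ 1 - √(1 - (1 / r) ^ 2) := by
  have : √(1 - (1 / r) ^ 2) ≤ √1 := sqrt_le_sqrt (by linarith [sq_nonneg (1 / r)])
  rw [sqrt_one] at this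
  linarith

theorem one_sub_sqrt_le {r : ℝ} (hr : 0 < r) :
    1 - √(1 - (1 / r) ^ 2) ≤ 2 * (1 + r ^ 2)⁻¹ := by
  rw [← div_eq_mul_inv, le_div_iff₀ (by positivity)]
  rcases le_or_gt r 1 with h | h
  · have := sqrt_nonneg (1 - (1 / r) ^ 2)
    nlinarith
  · have h0 : 1 / r < 1 := (div_lt_one hr).2 h
    have h1 : 0 ≤ 1 - (1 / r) ^ 2 := by nlinarith [show 0 < 1 / r by positivity]
    have h2 : 1 - (1 / r) ^ 2 ≤ √(1 - (1 / r) ^ 2) := by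
      refine le_sqrt_of_sq_le ?_
      nlinarith [sq_nonneg (1 / r)]
    have h3 : (1 / r) ^ 2 * (1 + r ^ 2) = (1 / r) ^ 2 + 1 := by field_simp
    have h4 : (1 / r) ^ 2 < 1 := by nlinarith [show 0 < 1 / r by positivity]
    nlinarith

theorem invKernel_nonneg (x : ℝ × ℝ) : 0 ≤ invKernel x :=
  mul_nonneg (div_nonneg zero_le_two (sqrt_nonneg _)) (one_sub_sqrt_nonneg _)

theorem integrable_invKernel : Integrable invKernel := by
  refine ⟨measurable_invKernel.aestronglyMeasurable, ?_⟩
  rw [hasFiniteIntegral_iff_ofReal (.of_forall invKernel_nonneg), ← lintegral_comp_polarCoord_symm,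
    polarCoord_target]
  have hi : IntegrableOn (fun p : ℝ × ℝ => 4 * (1 + p.1 ^ 2)⁻¹) (Ioi 0 ×ˢ Ioo (-π) π) := by
    rw [IntegrableOn, Measure.volume_eq_prod, ← Measure.prod_restrict]
    exact ((integrable_inv_one_add_sq.integrableOn).const_mul 4).comp_fst _
  refine lt_of_le_of_lt ?_ hi.lintegral_lt_top
  refine setLIntegral_mono' (measurableSet_Ioi.prod measurableSet_Ioo) ?_
  rintro ⟨r, φ⟩ ⟨hr, -⟩
  have hr' : 0 < r := hr
  simp only [polarCoord_symm_apply, smul_eq_mul]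
  rw [← ENNReal.ofReal_mul hr'.le, invKernel, pairNorm_polar hr'.le]
  refine ENNReal.ofReal_le_ofReal ?_
  have := one_sub_sqrt_le hr'
  have e : r * (2 / r * (1 - √(1 - (1 / r) ^ 2))) = 2 * (1 - √(1 - (1 / r) ^ 2)) := by
    field_simp
  rw [e]
  linarith

theorem integral_invKernel_pos : 0 < ∫ x, invKernel x := by
  rw [integral_pos_iff_support_of_nonneg invKernel_nonneg integrable_invKernel]
  have hU : IsOpen (Ioo (0 : ℝ) (1 / 2) ×ˢ Ioo (0 : ℝ) (1 / 2)) := isOpen_Ioo.prod isOpen_Ioo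
  have hne : (Ioo (0 : ℝ) (1 / 2) ×ˢ Ioo (0 : ℝ) (1 / 2)).Nonempty :=
    ⟨(1 / 4, 1 / 4), by norm_num⟩
  refine lt_of_lt_of_le (hU.measure_pos volume hne) (measure_mono ?_)
  rintro ⟨a, b⟩ ⟨⟨ha, ha'⟩, hb, hb'⟩
  simp only at ha ha' hb hb'
  have h0 : 0 < pairNorm (a, b) := sqrt_pos.2 (by positivity)
  have h1 : pairNorm (a, b) ≤ 1 := sqrt_le_one.2 (by simp only; nlinarith)
  have h2 : 1 ≤ 1 / pairNorm (a, b) := by rwa [le_div_iff₀ h0, one_mul]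
  rw [Function.mem_support, invKernel, sqrt_eq_zero_of_nonpos (by nlinarith)]
  simp [h0.ne']

/-- Radon's inversion formula in the plane, at the origin. -/
theorem tendsto_integral_lineInt_sub {h : ℝ × ℝ → ℝ} (hc : Continuous h)
    (hs : HasCompactSupport h) (he : ∀ x, h (-x) = h x) :
    Tendsto (fun ε => ∫ θ in (-π)..π, ∫ z, truncInvSq ε z * (lineInt h θ 0 - lineInt h θ z))
      (𝓝[>] 0) (𝓝 (h 0 * ∫ x, invKernel x)) := by
  have key : ∀ ε : ℝ, 0 < ε →
      ∫ θ in (-π)..π, ∫ z, truncInvSq ε z * (lineInt h θ 0 - lineInt h θ z) =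
        ∫ y, h (ε • y) * invKernel y := by
    intro ε hε
    obtain ⟨i1, i2, e1⟩ := integral_integral_trunc_lineInt hc hs hε
    have e2 : ∀ θ, ∫ z, truncInvSq ε z * (lineInt h θ 0 - lineInt h θ z) =
        ε⁻¹ * lineInt h θ 0 - ∫ z, truncInvSq ε z * lineInt h θ z := by
      intro θ
      simp_rw [mul_sub]
      rw [integral_sub ((integrable_truncInvSq hε).mul_const _)
        (integral_trunc_lineInt hc hs hε θ).1, integral_mul_const, integral_truncInvSq hε]
    have hcl : Continuous fun θ => lineInt h θ 0 :=
      (continuous_lineInt hc hs).comp (by fun_prop : Continuous fun θ : ℝ => (θ, (0 : ℝ)))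
    simp_rw [e2]
    rw [intervalIntegral.integral_sub ((hcl.intervalIntegrable _ _).const_mul _) i1, e1,
      intervalIntegral.integral_const_mul, integral_lineInt_zero hs hc he]
    have e3 : ∀ y : ℝ × ℝ, h (ε • y) * invKernel y =
        (fun x => h x * invKernel (ε⁻¹ • x)) (ε • y) := by
      intro y
      simp only
      rw [smul_smul, inv_mul_cancel₀ hε.ne', one_smul]
    rw [integral_congr_ae (.of_forall e3),
      Measure.integral_comp_smul volume (fun x => h x * invKernel (ε⁻¹ • x)) ε]
    have hfr : Module.finrank ℝ (ℝ × ℝ) = 2 := by simp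
    have hsm : ∀ x : ℝ × ℝ, pairNorm (ε⁻¹ • x) = ε⁻¹ * pairNorm x := by
      intro x
      rw [pairNorm, pairNorm, ← sqrt_sq (show 0 ≤ ε⁻¹ by positivity), ← sqrt_mul (by positivity),
        sqrt_sq (show 0 ≤ ε⁻¹ by positivity)]
      congr 1
      simp
      ring
    have e4 : ∀ x : ℝ × ℝ, h x * invKernel (ε⁻¹ • x) =
        ε ^ 2 * (ε⁻¹ * (2 / pairNorm x * h x)) -
          ε ^ 2 * (2 / (ε * pairNorm x) * √(1 - (ε / pairNorm x) ^ 2) * h x) := by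
      intro x
      rw [invKernel, hsm]
      have : 1 / (ε⁻¹ * pairNorm x) = ε / pairNorm x := by
        rw [one_div, mul_inv, inv_inv, div_eq_mul_inv]
      rw [this]
      rcases eq_or_ne (pairNorm x) 0 with h0 | h0
      · simp [h0]
      · field_simp
    have i3 : Integrable fun x => 2 / pairNorm x * h x := integrable_div_pairNorm hs hc
    simp_rw [e4]
    rw [integral_sub ((i3.const_mul _).const_mul _) (i2.const_mul _), integral_const_mul,
      integral_const_mul, integral_const_mul, hfr, abs_of_pos (by positivity), smul_eq_mul]
    field_simp
  have hb : ∃ C, ∀ x, ‖h x‖ ≤ C := hs.exists_bound_of_continuous hc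
  obtain ⟨C, hC⟩ := hb
  have lim : Tendsto (fun ε : ℝ => ∫ y, h (ε • y) * invKernel y) (𝓝[>] 0)
      (𝓝 (∫ y, h 0 * invKernel y)) := by
    refine tendsto_integral_filter_of_dominated_convergence (fun y => C * invKernel y) ?_ ?_
      (integrable_invKernel.const_mul C) ?_
    · refine .of_forall fun ε => ?_
      exact (((hc.comp (by fun_prop)).measurable).mul measurable_invKernel).aestronglyMeasurable
    · refine .of_forall fun ε => .of_forall fun y => ?_
      rw [norm_mul, norm_of_nonneg (invKernel_nonneg y)]
      exact mul_le_mul_of_nonneg_right (hC _) (invKernel_nonneg y)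
    · refine .of_forall fun y => ?_
      refine Tendsto.mul_const _ ?_
      have : Tendsto (fun ε : ℝ => h (ε • y)) (𝓝 0) (𝓝 (h ((0 : ℝ) • y))) :=
        (hc.comp (by fun_prop : Continuous fun ε : ℝ => ε • y)).tendsto 0
      rw [zero_smul] at this
      exact this.mono_left nhdsWithin_le_nhds
  rw [integral_const_mul] at lim
  refine lim.congr' ?_
  filter_upwards [self_mem_nhdsWithin] with ε hε
  exact (key ε hε).symm

theorem hausdorffMeasure_sphere_complex_pos : 0 < μH[1] (sphere (0 : ℂ) 1) := by
  have h : (LipschitzOnWith 1 Complex.re (sphere (0 : ℂ) 1)) := by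
    refine LipschitzOnWith.of_dist_le_mul fun x _ y _ => ?_
    rw [NNReal.coe_one, one_mul, Real.dist_eq, ← Complex.sub_re, dist_eq_norm]
    exact Complex.abs_re_le_norm _
  have h2 := h.hausdorffMeasure_image_le (d := 1) zero_le_one
  have h3 : Icc (-1 : ℝ) 1 ⊆ Complex.re '' sphere (0 : ℂ) 1 := by
    intro x hx
    refine ⟨⟨x, √(1 - x ^ 2)⟩, ?_, rfl⟩
    rw [mem_sphere_zero_iff_norm, Complex.norm_eq_sqrt_sq_add_sq, sqrt_eq_one]
    simp only
    rw [sq_sqrt (by nlinarith [hx.1, hx.2])]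
    ring
  have h4 := measure_mono (μ := (μH[1] : Measure ℝ)) h3
  rw [hausdorffMeasure_real, Real.volume_Icc] at h4
  rw [ENNReal.coe_one, ENNReal.one_rpow, one_mul, hausdorffMeasure_real] at h2
  refine lt_of_lt_of_le ?_ (h4.trans h2)
  norm_num

theorem hausdorffMeasure_sphere_complex_lt_top : μH[1] (sphere (0 : ℂ) 1) < ∞ := by
  have h : LipschitzOnWith 1 (fun θ : ℝ => Complex.exp (θ * Complex.I)) (Icc (-π) π) := by
    refine LipschitzOnWith.of_dist_le_mul fun x _ y _ => ?_
    rw [NNReal.coe_one, one_mul, Real.dist_eq, dist_eq_norm]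
    have : Complex.exp (x * Complex.I) - Complex.exp (y * Complex.I) =
        Complex.exp (y * Complex.I) * (Complex.exp (Complex.I * ((x - y : ℝ) : ℂ)) - 1) := by
      rw [mul_sub, ← Complex.exp_add, mul_one]
      congr 2
      push_cast
      ring
    rw [this, norm_mul, Complex.norm_exp_ofReal_mul_I, one_mul]
    exact Real.norm_exp_I_mul_ofReal_sub_one_le
  have h2 := h.hausdorffMeasure_image_le (d := 1) zero_le_one
  rw [ENNReal.coe_one, ENNReal.one_rpow, one_mul, hausdorffMeasure_real, Real.volume_Icc] at h2
  refine lt_of_le_of_lt (measure_mono ?_) (h2.trans_lt ENNReal.ofReal_lt_top)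
  intro z hz
  rw [mem_sphere_zero_iff_norm] at hz
  refine ⟨z.arg, ⟨(Complex.neg_pi_lt_arg z).le, Complex.arg_le_pi z⟩, ?_⟩
  have := Complex.norm_mul_exp_arg_mul_I z
  simpa [hz] using this

theorem exists_integral_sphere_complex :
    ∃ c : ℝ, 0 < c ∧ ∀ g : ℂ → ℝ, ∫ z in sphere (0 : ℂ) 1, g z ∂μH[1] =
      c * ∫ θ in (-π)..π, g (Complex.exp (θ * Complex.I)) := by
  have : Fact (0 < 2 * π) := ⟨two_pi_pos⟩
  set p : AddCircle (2 * π) → ℂ := fun t => (AddCircle.toCircle t : ℂ) with hp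
  have hpc : Continuous p := by
    exact continuous_subtype_val.comp AddCircle.continuous_toCircle
  have hpi : Function.Injective p :=
    Subtype.val_injective.comp (AddCircle.injective_toCircle (by positivity))
  have hpe : MeasurableEmbedding p := (hpc.isClosedEmbedding hpi).measurableEmbedding
  have hpmk : ∀ x : ℝ, p x = Complex.exp (x * Complex.I) := by
    intro x
    simp only [hp, AddCircle.toCircle_apply_mk, Circle.coe_exp]
    congr 2
    field_simp
  have hrange : range p = sphere (0 : ℂ) 1 := by
    ext z
    rw [mem_sphere_zero_iff_norm]
    constructor
    · rintro ⟨t, rfl⟩; exact Circle.norm_coe _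
    · intro hz
      refine ⟨(z.arg : AddCircle (2 * π)), ?_⟩
      have := Complex.norm_mul_exp_arg_mul_I z
      rw [hpmk]
      simpa [hz] using this
  set ν : Measure (AddCircle (2 * π)) := Measure.comap p μH[1] with hν
  have hνs : ∀ s, ν s = μH[1] (p '' s) := fun s => hpe.comap_apply _ s
  have hinv : ν.IsAddLeftInvariant := by
    refine ⟨fun x => ?_⟩
    ext s hs
    rw [Measure.map_apply (measurable_const_add x) hs, hνs, hνs,
      ← (rotation (AddCircle.toCircle x)).toIsometryEquiv.hausdorffMeasure_image, ← image_comp]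
    congr 1
    have : (rotation (AddCircle.toCircle x)).toIsometryEquiv ∘ p = p ∘ (fun y => x + y) := by
      ext y
      simp [hp, AddCircle.toCircle_add]
    rw [this, image_comp, image_preimage_eq _ (add_left_surjective x)]
  have hfin : IsFiniteMeasure ν := by
    refine ⟨?_⟩
    rw [hνs, image_univ, hrange]
    exact hausdorffMeasure_sphere_complex_lt_top
  have hu := Measure.isAddInvariant_eq_smul_of_compactSpace ν (volume : Measure (AddCircle (2 * π)))
  set k := Measure.addHaarScalarFactor ν (volume : Measure (AddCircle (2 * π)))
  have hk : 0 < k := by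
    rw [pos_iff_ne_zero]
    intro h0
    have h1 : ν univ = 0 := by rw [hu, h0]; simp
    rw [hνs, image_univ, hrange] at h1
    exact hausdorffMeasure_sphere_complex_pos.ne' h1
  refine ⟨k, hk, fun g => ?_⟩
  rw [← hrange, ← hpe.map_comap, hpe.integral_map, ← hν, hu, integral_smul_nnreal_measure]
  have := AddCircle.intervalIntegral_preimage (2 * π) (-π) (fun t => g (p t))
  have e : -π + 2 * π = π := by ring
  rw [e] at this
  rw [← this, NNReal.smul_def, smul_eq_mul]
  simp_rw [hpmk]

/-- Planar Hausdorff measure is a multiple of Lebesgue measure. -/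
theorem exists_hausdorffMeasure_complex :
    ∃ c : ℝ, 0 < c ∧ ∀ S : Set (ℝ × ℝ), MeasurableSet S →
      (μH[2] ({z : ℂ | (z.re, z.im) ∈ S})).toReal = c * (volume S).toReal := by
  have hH : (μH[(Module.finrank ℝ ℂ : ℝ)] : Measure ℂ).IsAddHaarMeasure := inferInstance
  rw [Complex.finrank_real_complex] at hH
  have hH' : (μH[2] : Measure ℂ).IsAddHaarMeasure := by exact_mod_cast hH
  have hu := Measure.isAddLeftInvariant_eq_smul (μH[2] : Measure ℂ) (volume : Measure ℂ)
  set k := Measure.addHaarScalarFactor (μH[2] : Measure ℂ) (volume : Measure ℂ)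
  have hk : 0 < k := Measure.addHaarScalarFactor_pos_of_isAddHaarMeasure _ _
  refine ⟨k, hk, fun S hS => ?_⟩
  have : volume {z : ℂ | (z.re, z.im) ∈ S} = volume S :=
    Complex.volume_preserving_equiv_real_prod.measure_preimage hS.nullMeasurableSet
  rw [hu, Measure.smul_apply, this]
  simp

/-- `a, b, c` is an orthonormal frame of `ℝ³`. -/
structure IsFrame (a b c : E 3) : Prop where
  aa : ⟪a, a⟫ = 1
  bb : ⟪b, b⟫ = 1
  cc : ⟪c, c⟫ = 1
  ab : ⟪a, b⟫ = 0
  ac : ⟪a, c⟫ = 0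
  bc : ⟪b, c⟫ = 0

namespace IsFrame

variable {a b c : E 3}

theorem ba (h : IsFrame a b c) : ⟪b, a⟫ = 0 := by rw [real_inner_comm, h.ab]
theorem ca (h : IsFrame a b c) : ⟪c, a⟫ = 0 := by rw [real_inner_comm, h.ac]
theorem cb (h : IsFrame a b c) : ⟪c, b⟫ = 0 := by rw [real_inner_comm, h.bc]

theorem norm_c (h : IsFrame a b c) : ‖c‖ = 1 := by
  rw [← sq_eq_sq₀ (norm_nonneg _) zero_le_one, ← real_inner_self_eq_norm_sq, h.cc, one_pow]

theorem norm_a (h : IsFrame a b c) : ‖a‖ = 1 := by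
  rw [← sq_eq_sq₀ (norm_nonneg _) zero_le_one, ← real_inner_self_eq_norm_sq, h.aa, one_pow]

theorem norm_b (h : IsFrame a b c) : ‖b‖ = 1 := by
  rw [← sq_eq_sq₀ (norm_nonneg _) zero_le_one, ← real_inner_self_eq_norm_sq, h.bb, one_pow]

theorem norm_sq (h : IsFrame a b c) (x y z : ℝ) :
    ‖x • a + y • b + z • c‖ ^ 2 = x ^ 2 + y ^ 2 + z ^ 2 := by
  rw [← real_inner_self_eq_norm_sq]
  simp only [inner_add_left, inner_add_right, real_inner_smul_left, real_inner_smul_right,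
    h.aa, h.bb, h.cc, h.ab, h.ac, h.bc, h.ba, h.ca, h.cb]
  ring

theorem norm_sq_plane (h : IsFrame a b c) (x y : ℝ) : ‖x • a + y • b‖ ^ 2 = x ^ 2 + y ^ 2 := by
  simpa using h.norm_sq x y 0

theorem orthonormal (h : IsFrame a b c) : Orthonormal ℝ ![a, b, c] := by
  rw [orthonormal_iff_ite]
  intro i j
  fin_cases i <;> fin_cases j <;>
    simp [h.norm_a, h.norm_b, h.norm_c, h.ab, h.ac, h.bc, h.ba, h.ca, h.cb]

theorem eq_sum (h : IsFrame a b c) (x : E 3) : x = ⟪a, x⟫ • a + ⟪b, x⟫ • b + ⟪c, x⟫ • c := by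
  set B := basisOfOrthonormalOfCardEqFinrank h.orthonormal (by simp)
  have hB : (B : Fin 3 → E 3) = ![a, b, c] := coe_basisOfOrthonormalOfCardEqFinrank _ _
  set OB := B.toOrthonormalBasis (by rw [hB]; exact h.orthonormal) with hOB
  have := OB.sum_repr' x
  rw [Fin.sum_univ_three, hOB, Module.Basis.coe_toOrthonormalBasis, hB] at this
  exact this.symm

theorem of_orthonormalBasis (B : OrthonormalBasis (Fin 3) ℝ (E 3)) :
    IsFrame (B 0) (B 1) (B 2) := by
  have := orthonormal_iff_ite.1 B.orthonormal
  constructor <;> rw [this] <;> simp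

theorem map (h : IsFrame a b c) (T : E 3 ≃ₗᵢ[ℝ] E 3) : IsFrame (T a) (T b) (T c) := by
  constructor <;> rw [LinearIsometryEquiv.inner_map_map]
  exacts [h.aa, h.bb, h.cc, h.ab, h.ac, h.bc]

end IsFrame

theorem exists_isFrame {c : E 3} (hc : ‖c‖ = 1) : ∃ a b, IsFrame a b c := by
  have h1 : Orthonormal ℝ (({2} : Set (Fin 3)).domRestrict (fun _ : Fin 3 => c)) := by
    refine ⟨fun i => hc, fun i j hij => ?_⟩
    exact absurd (Subsingleton.elim i j) hij
  obtain ⟨B, hB⟩ := h1.exists_orthonormalBasis_extension_of_card_eq (by simp)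
  have := IsFrame.of_orthonormalBasis B
  rw [hB 2 rfl] at this
  exact ⟨_, _, this⟩

/-- The isometric embedding of the plane as the first two frame directions. -/
theorem IsFrame.isometry_plane {a b c : E 3} (h : IsFrame a b c) :
    Isometry fun z : ℂ => z.re • a + z.im • b := by
  refine Isometry.of_dist_eq fun z w => ?_
  rw [dist_eq_norm, dist_eq_norm, ← sq_eq_sq₀ (norm_nonneg _) (norm_nonneg _),
    Complex.sq_norm, Complex.normSq_apply]
  have : z.re • a + z.im • b - (w.re • a + w.im • b) = (z - w).re • a + (z - w).im • b := by
    simp only [Complex.sub_re, Complex.sub_im]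
    module
  rw [this, h.norm_sq_plane]
  ring

theorem IsFrame.range_plane {a b c : E 3} (h : IsFrame a b c) :
    range (fun z : ℂ => z.re • a + z.im • b) = hyperplane c := by
  ext x
  simp only [hyperplane, mem_ofPred_eq, mem_range]
  constructor
  · rintro ⟨z, rfl⟩
    simp [inner_add_left, real_inner_smul_left, h.ac, h.bc]
  · intro hx
    refine ⟨⟨⟪a, x⟫, ⟪b, x⟫⟩, ?_⟩
    have := h.eq_sum x
    rw [real_inner_comm x c, hx, zero_smul, add_zero] at this
    exact this.symm

theorem exists_integral_greatCircle :
    ∃ k : ℝ, 0 < k ∧ ∀ a b c : E 3, IsFrame a b c → ∀ g : E 3 → ℝ,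
      ∫ v in (sphere (0 : E 3) 1 ∩ hyperplane c), g v ∂μH[1] =
        k * ∫ θ in (-π)..π, g (cos θ • a + sin θ • b) := by
  obtain ⟨k, hk, hk'⟩ := exists_integral_sphere_complex
  refine ⟨k, hk, fun a b c h g => ?_⟩
  set T : ℂ → E 3 := fun z => z.re • a + z.im • b with hT
  have hTe : MeasurableEmbedding T := h.isometry_plane.isClosedEmbedding.measurableEmbedding
  have e1 : (μH[1] : Measure (E 3)).restrict (sphere (0 : E 3) 1 ∩ hyperplane c) =
      Measure.map T (μH[1].restrict (sphere (0 : ℂ) 1)) := by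
    rw [← Measure.restrict_restrict isClosed_sphere.measurableSet, ← h.range_plane,
      ← h.isometry_plane.map_hausdorffMeasure (.inl zero_le_one), hTe.restrict_map]
    congr 2
    ext z
    rw [mem_preimage, mem_sphere_zero_iff_norm, mem_sphere_zero_iff_norm,
      h.isometry_plane.norm_map_of_map_zero (by simp)]
  rw [e1, hTe.integral_map, hk']
  simp [hT, Complex.exp_ofReal_mul_I_re, Complex.exp_ofReal_mul_I_im]

theorem exists_hausdorffMeasure_section :
    ∃ k : ℝ, 0 < k ∧ ∀ a b c : E 3, IsFrame a b c → ∀ M : Set (E 3), MeasurableSet M →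
      (μH[2] (M ∩ hyperplane c)).toReal =
        k * (volume {p : ℝ × ℝ | p.1 • a + p.2 • b ∈ M}).toReal := by
  obtain ⟨k, hk, hk'⟩ := exists_hausdorffMeasure_complex
  refine ⟨k, hk, fun a b c h M hM => ?_⟩
  have hm : MeasurableSet {p : ℝ × ℝ | p.1 • a + p.2 • b ∈ M} :=
    hM.preimage (by fun_prop : Measurable fun p : ℝ × ℝ => p.1 • a + p.2 • b)
  rw [← hk' _ hm, ← h.range_plane, ← h.isometry_plane.hausdorffMeasure_preimage (.inl zero_le_two)]
  rfl

/-- Smooth compactly supported even functions with a quasi-concavity property. -/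
structure IsProfile (f : E 3 → ℝ) : Prop where
  contDiff : ContDiff ℝ 2 f
  compact : HasCompactSupport f
  nonneg : ∀ x, 0 ≤ f x
  even : ∀ x, f (-x) = f x
  quasi : ∀ x y, min (f x) (f y) ≤ f ((2⁻¹ : ℝ) • (x - y))

/-- The integral of `f` over the plane at height `z` over the plane spanned by `a, b`. -/
def sectionInt (f : E 3 → ℝ) (a b c : E 3) (z : ℝ) : ℝ :=
  ∫ p : ℝ × ℝ, f (p.1 • a + p.2 • b + z • c)

/-- The Radon-type density in direction `c`. -/
def sectionDensity (f : E 3 → ℝ) (a b c : E 3) : ℝ :=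
  ∫ z in Ioi (0 : ℝ), (z ^ 2)⁻¹ * (sectionInt f a b c 0 - sectionInt f a b c z)

theorem sectionInt_eq_of_isFrame {f : E 3 → ℝ} {a b a' b' c : E 3} (h : IsFrame a b c)
    (h' : IsFrame a' b' c) (z : ℝ) : sectionInt f a' b' c z = sectionInt f a b c z := by
  have ea := h.eq_sum a'
  have eb := h.eq_sum b'
  rw [h'.ca, zero_smul, add_zero] at ea
  rw [h'.cb, zero_smul, add_zero] at eb
  set α := ⟪a, a'⟫
  set γ := ⟪b, a'⟫
  set β := ⟪a, b'⟫
  set δ := ⟪b, b'⟫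
  have h1 : α ^ 2 + γ ^ 2 = 1 := by rw [← h.norm_sq_plane, ← ea, h'.norm_a, one_pow]
  have h2 : β ^ 2 + δ ^ 2 = 1 := by rw [← h.norm_sq_plane, ← eb, h'.norm_b, one_pow]
  have h3 : α * β + γ * δ = 0 := by
    have := h'.ab
    rw [ea, eb] at this
    simp [inner_add_left, inner_add_right, real_inner_smul_left, real_inner_smul_right,
      h.norm_a, h.norm_b, h.ab, h.ba] at this
    linarith
  have hdet : |α * δ - β * γ| = 1 := by
    rw [← sq_eq_sq₀ (abs_nonneg _) zero_le_one, sq_abs, one_pow]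
    linear_combination (β ^ 2 + δ ^ 2) * h1 + h2 - (α * β + γ * δ) * h3
  rw [sectionInt, sectionInt,
    ← integral_comp_prod_linear hdet (fun p => f (p.1 • a + p.2 • b + z • c))]
  congr 1
  ext p
  simp only
  rw [ea, eb]
  congr 1
  module

namespace IsProfile

variable {f : E 3 → ℝ}

theorem continuous (hf : IsProfile f) : Continuous f := hf.contDiff.continuous

theorem exists_radius (hf : IsProfile f) : ∃ R : ℝ, 0 < R ∧ ∀ x, R < ‖x‖ → f x = 0 := by
  obtain ⟨R, hR⟩ := hf.compact.isCompact.isBounded.exists_norm_le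
  refine ⟨|R| + 1, by positivity, fun x hx => ?_⟩
  by_contra hne
  have := hR x (subset_closure hne)
  linarith [le_abs_self R]

theorem exists_bound (hf : IsProfile f) : ∃ M : ℝ, ∀ x, f x ≤ M := by
  obtain ⟨M, hM⟩ := hf.compact.exists_bound_of_continuous hf.continuous
  exact ⟨M, fun x => (le_abs_self _).trans (hM x)⟩

theorem exists_second_difference (hf : IsProfile f) :
    ∃ L : ℝ, 0 ≤ L ∧ ∀ x y, |2 * f x - f (x + y) - f (x - y)| ≤ L * ‖y‖ ^ 2 := by
  have h1 : ContDiff ℝ 1 (fderiv ℝ f) := hf.contDiff.fderiv_right (by norm_num)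
  obtain ⟨K, hK⟩ := h1.lipschitzWith_of_hasCompactSupport (hf.compact.fderiv ℝ) one_ne_zero
  have hd : Differentiable ℝ f := hf.contDiff.differentiable (by norm_num)
  refine ⟨2 * K, by positivity, fun x y => ?_⟩
  have hder : ∀ t : ℝ, HasDerivAt (fun t : ℝ => f (x + t • y) + f (x - t • y))
      (fderiv ℝ f (x + t • y) y - fderiv ℝ f (x - t • y) y) t := by
    intro t
    have e1 : HasDerivAt (fun t : ℝ => x + t • y) y t := by
      simpa using ((hasDerivAt_id t).smul_const y).const_add x
    have e2 : HasDerivAt (fun t : ℝ => x - t • y) (-y) t := by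
      simpa using ((hasDerivAt_id t).smul_const y).const_sub x
    have := ((hd _).hasFDerivAt.comp_hasDerivAt t e1).add ((hd _).hasFDerivAt.comp_hasDerivAt t e2)
    exact this.congr_deriv (by rw [map_neg, ← sub_eq_add_neg])
  have := norm_image_sub_le_of_norm_deriv_le_segment_01' (C := 2 * K * ‖y‖ ^ 2)
    (fun t _ => (hder t).hasDerivWithinAt) ?_
  · simp only [one_smul, zero_smul, add_zero, sub_zero, norm_eq_abs] at this
    rw [← abs_neg]
    convert this using 2
    ring
  · intro t ht
    rw [← sub_apply]
    refine (ContinuousLinearMap.le_opNorm _ _).trans ?_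
    have h2 := hK.dist_le_mul (x + t • y) (x - t • y)
    rw [dist_eq_norm, dist_eq_norm] at h2
    have h3 : x + t • y - (x - t • y) = (2 * t) • y := by module
    rw [h3, norm_smul, norm_eq_abs, abs_of_nonneg (by linarith [ht.1])] at h2
    have h4 : K * (2 * t * ‖y‖) ≤ 2 * K * ‖y‖ := by
      have : 0 ≤ (K : ℝ) * ‖y‖ := by positivity
      nlinarith [ht.2]
    nlinarith [norm_nonneg y]

end IsProfile

theorem IsFrame.abs_le_norm {a b c : E 3} (h : IsFrame a b c) (x y z : ℝ) :
    |x| ≤ ‖x • a + y • b + z • c‖ ∧ |y| ≤ ‖x • a + y • b + z • c‖ ∧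
      |z| ≤ ‖x • a + y • b + z • c‖ := by
  have := h.norm_sq x y z
  refine ⟨abs_le_of_sq_le_sq ?_ (norm_nonneg _), abs_le_of_sq_le_sq ?_ (norm_nonneg _),
    abs_le_of_sq_le_sq ?_ (norm_nonneg _)⟩ <;>
  nlinarith [sq_nonneg x, sq_nonneg y, sq_nonneg z]

theorem sectionInt_eq_box {f : E 3 → ℝ} {R : ℝ} (hR : ∀ x, R < ‖x‖ → f x = 0) {a b c : E 3}
    (h : IsFrame a b c) (z : ℝ) : sectionInt f a b c z =
      ∫ p in Icc (-R) R ×ˢ Icc (-R) R, f (p.1 • a + p.2 • b + z • c) := by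
  refine (setIntegral_eq_integral_of_forall_compl_eq_zero fun p hp => hR _ ?_).symm
  by_contra hle
  obtain ⟨h1, h2, -⟩ := h.abs_le_norm p.1 p.2 z
  exact hp ⟨abs_le.1 (h1.trans (not_lt.1 hle)), abs_le.1 (h2.trans (not_lt.1 hle))⟩

theorem continuous_sectionInt_box {f : E 3 → ℝ} (hf : Continuous f) (R : ℝ) :
    Continuous fun q : (E 3 × E 3 × E 3) × ℝ => ∫ p in Icc (-R) R ×ˢ Icc (-R) R,
      f (p.1 • q.1.1 + p.2 • q.1.2.1 + q.2 • q.1.2.2) :=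
  continuous_parametric_integral_of_continuous (by fun_prop) (isCompact_Icc.prod isCompact_Icc)

namespace IsProfile

variable {f : E 3 → ℝ} {a b c : E 3}

theorem hasCompactSupport_section (hf : IsProfile f) (h : IsFrame a b c) (z : ℝ) :
    HasCompactSupport fun p : ℝ × ℝ => f (p.1 • a + p.2 • b + z • c) := by
  obtain ⟨R, -, hR⟩ := hf.exists_radius
  refine HasCompactSupport.intro (K := Icc (-R) R ×ˢ Icc (-R) R)
    (isCompact_Icc.prod isCompact_Icc) fun p hp => hR _ ?_
  by_contra hle
  obtain ⟨h1, h2, -⟩ := h.abs_le_norm p.1 p.2 z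
  exact hp ⟨abs_le.1 (h1.trans (not_lt.1 hle)), abs_le.1 (h2.trans (not_lt.1 hle))⟩

theorem integrable_section (hf : IsProfile f) (h : IsFrame a b c) (z : ℝ) :
    Integrable fun p : ℝ × ℝ => f (p.1 • a + p.2 • b + z • c) := by
  have := hf.continuous
  exact Continuous.integrable_of_hasCompactSupport (by fun_prop) (hf.hasCompactSupport_section h z)

theorem continuous_sectionInt (hf : IsProfile f) (h : IsFrame a b c) :
    Continuous (sectionInt f a b c) := by
  obtain ⟨R, -, hR⟩ := hf.exists_radius
  rw [funext (sectionInt_eq_box hR h)]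
  exact (continuous_sectionInt_box hf.continuous R).comp
    (by fun_prop : Continuous fun z : ℝ => ((a, b, c), z))

theorem sectionInt_nonneg (hf : IsProfile f) (z : ℝ) : 0 ≤ sectionInt f a b c z :=
  integral_nonneg fun _ => hf.nonneg _

theorem sectionInt_neg (hf : IsProfile f) (z : ℝ) :
    sectionInt f a b c (-z) = sectionInt f a b c z := by
  rw [sectionInt, ← integral_neg_eq_self, sectionInt]
  congr 1
  ext p
  rw [← hf.even]
  congr 1
  simp only [Prod.fst_neg, Prod.snd_neg]
  module

theorem sectionInt_le (hf : IsProfile f) (h : IsFrame a b c) (z : ℝ) :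
    sectionInt f a b c z ≤ sectionInt f a b c 0 := by
  have := hf.continuous
  refine integral_le_integral_of_half_sub (by fun_prop) (by fun_prop)
    (hf.hasCompactSupport_section h z) (hf.hasCompactSupport_section h 0)
    (fun _ => hf.nonneg _) (fun _ => hf.nonneg _) fun p q => ?_
  convert hf.quasi (p.1 • a + p.2 • b + z • c) (q.1 • a + q.2 • b + z • c) using 2
  simp only [Prod.smul_fst, Prod.smul_snd, Prod.fst_sub, Prod.snd_sub, smul_eq_mul]
  module

theorem exists_section_bounds (hf : IsProfile f) : ∃ C : ℝ, 0 ≤ C ∧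
    ∀ a b c, IsFrame a b c → ∀ z, sectionInt f a b c 0 - sectionInt f a b c z ≤ C * z ^ 2 ∧
      sectionInt f a b c 0 - sectionInt f a b c z ≤ C := by
  obtain ⟨R, hR0, hR⟩ := hf.exists_radius
  obtain ⟨M, hM⟩ := hf.exists_bound
  obtain ⟨L, hL0, hL⟩ := hf.exists_second_difference
  have hM0 : 0 ≤ M := (hf.nonneg 0).trans (hM 0)
  set B : Set (ℝ × ℝ) := Icc (-R) R ×ˢ Icc (-R) R with hB
  have hBf : volume B ≠ ∞ := (isCompact_Icc.prod isCompact_Icc).measure_lt_top.ne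
  set V := (volume B).toReal with hV
  have hV0 : 0 ≤ V := ENNReal.toReal_nonneg
  refine ⟨max (M * V) (L * V / 2), le_max_of_le_left (by positivity), ?_⟩
  intro a b c h z
  constructor
  · have hB' : sectionInt f a b c 0 - sectionInt f a b c z ≤ L * V / 2 * z ^ 2 := by
      have e1 : 2 * (sectionInt f a b c 0 - sectionInt f a b c z) =
          2 * sectionInt f a b c 0 - sectionInt f a b c z - sectionInt f a b c (-z) := by
        rw [hf.sectionInt_neg]; ring
      have e2 : 2 * sectionInt f a b c 0 - sectionInt f a b c z - sectionInt f a b c (-z) =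
          ∫ p in B, (2 * f (p.1 • a + p.2 • b + (0 : ℝ) • c) - f (p.1 • a + p.2 • b + z • c)
            - f (p.1 • a + p.2 • b + (-z) • c)) := by
        rw [integral_sub, integral_sub, integral_const_mul, ← sectionInt_eq_box hR h,
          ← sectionInt_eq_box hR h, ← sectionInt_eq_box hR h]
        · exact ((hf.integrable_section h 0).integrableOn).const_mul 2
        · exact (hf.integrable_section h z).integrableOn
        · exact (((hf.integrable_section h 0).integrableOn).const_mul 2).sub
            (hf.integrable_section h z).integrableOn
        · exact (hf.integrable_section h (-z)).integrableOn
      have e3 := norm_setIntegral_le_of_norm_le_const (μ := volume) (s := B) (C := L * z ^ 2)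
        (f := fun p => 2 * f (p.1 • a + p.2 • b + (0 : ℝ) • c) - f (p.1 • a + p.2 • b + z • c)
            - f (p.1 • a + p.2 • b + (-z) • c)) hBf.lt_top ?_
      · rw [← e2, ← e1, measureReal_def, ← hV] at e3
        have := (le_abs_self _).trans e3
        linarith
      · intro p _
        have := hL (p.1 • a + p.2 • b) (z • c)
        rw [norm_smul, h.norm_c, mul_one, norm_eq_abs, sq_abs] at this
        rw [norm_eq_abs]
        convert this using 3
        · simp
        · rw [neg_smul, sub_eq_add_neg]
    refine hB'.trans ?_
    gcongr
    exact le_max_right _ _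
  · refine le_trans ?_ (le_max_left _ _)
    have e3 := norm_setIntegral_le_of_norm_le_const (μ := volume) (s := B) (C := M)
        (f := fun p => f (p.1 • a + p.2 • b + (0 : ℝ) • c)) hBf.lt_top ?_
    · rw [← sectionInt_eq_box hR h, measureReal_def, ← hV] at e3
      have := (le_abs_self _).trans e3
      linarith [hf.sectionInt_nonneg (a := a) (b := b) (c := c) z]
    · intro p _
      rw [norm_of_nonneg (hf.nonneg _)]
      exact hM _

/-- A common integrable majorant for the integrands of `sectionDensity`. -/
theorem exists_majorant (hf : IsProfile f) : ∃ D : ℝ → ℝ, IntegrableOn D (Ioi 0) ∧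
    ∀ a b c, IsFrame a b c → ∀ z, 0 < z →
      ‖(z ^ 2)⁻¹ * (sectionInt f a b c 0 - sectionInt f a b c z)‖ ≤ D z := by
  obtain ⟨C, hC0, hC⟩ := hf.exists_section_bounds
  refine ⟨fun z => 2 * C * (1 + z ^ 2)⁻¹, (integrable_inv_one_add_sq.const_mul _).integrableOn, ?_⟩
  intro a b c h z hz
  obtain ⟨h1, h2⟩ := hC a b c h z
  have h0 := hf.sectionInt_le h z
  show _ ≤ 2 * C * (1 + z ^ 2)⁻¹
  rw [norm_of_nonneg (mul_nonneg (by positivity) (by linarith)), inv_mul_eq_div,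
    ← div_eq_mul_inv, div_le_div_iff₀ (by positivity) (by positivity)]
  have : 0 < z ^ 2 := by positivity
  nlinarith

theorem sectionDensity_nonneg (hf : IsProfile f) (h : IsFrame a b c) :
    0 ≤ sectionDensity f a b c :=
  integral_nonneg fun z => mul_nonneg (by positivity) (by linarith [hf.sectionInt_le h z])

theorem continuousOn_sectionDensity (hf : IsProfile f) :
    ContinuousOn (fun q : E 3 × E 3 × E 3 => sectionDensity f q.1 q.2.1 q.2.2)
      {q | IsFrame q.1 q.2.1 q.2.2} := by
  obtain ⟨D, hD, hD'⟩ := hf.exists_majorant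
  obtain ⟨R, -, hR⟩ := hf.exists_radius
  refine continuousOn_of_dominated (bound := D) ?_ ?_ hD ?_
  · intro q hq
    refine Measurable.aestronglyMeasurable ?_
    have := (hf.continuous_sectionInt hq).measurable
    fun_prop
  · intro q hq
    filter_upwards [ae_restrict_mem measurableSet_Ioi] with z hz
    exact hD' _ _ _ hq z hz
  · refine .of_forall fun z => ?_
    have hz : ∀ z, ContinuousOn (fun q : E 3 × E 3 × E 3 => sectionInt f q.1 q.2.1 q.2.2 z)
        {q | IsFrame q.1 q.2.1 q.2.2} := by
      intro z
      refine ContinuousOn.congr (Continuous.continuousOn ((continuous_sectionInt_box hf.continuous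
        R).comp (by fun_prop : Continuous fun q : E 3 × E 3 × E 3 => (q, z)))) ?_
      intro q hq
      exact sectionInt_eq_box hR hq z
    exact ((hz 0).sub (hz z)).const_smul (z ^ 2)⁻¹

end IsProfile

open Classical in
/-- The density as a function of the direction only. -/
def profileDensity (f : E 3 → ℝ) (c : E 3) : ℝ :=
  if h : ∃ a b, IsFrame a b c then sectionDensity f h.choose h.choose_spec.choose c else 0

theorem profileDensity_eq (f : E 3 → ℝ) {a b c : E 3} (h : IsFrame a b c) :
    profileDensity f c = sectionDensity f a b c := by
  have hex : ∃ a b, IsFrame a b c := ⟨a, b, h⟩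
  rw [profileDensity, dif_pos hex, sectionDensity, sectionDensity]
  simp_rw [sectionInt_eq_of_isFrame h hex.choose_spec.choose_spec]

theorem IsFrame.neg_right {a b c : E 3} (h : IsFrame a b c) : IsFrame a b (-c) :=
  ⟨h.aa, h.bb, by simp [h.norm_c], h.ab, by simp [h.ac], by simp [h.bc]⟩

theorem IsFrame.rotate {a b c : E 3} (h : IsFrame a b c) (θ : ℝ) :
    IsFrame (-sin θ • a + cos θ • b) c (cos θ • a + sin θ • b) := by
  have := sin_sq_add_cos_sq θ
  constructor <;>
    simp only [inner_add_left, inner_add_right, real_inner_smul_left, real_inner_smul_right,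
      h.aa, h.bb, h.cc, h.ab, h.ac, h.bc, h.ba, h.ca, h.cb] <;> linarith

namespace IsProfile

variable {f : E 3 → ℝ}

theorem profileDensity_nonneg (hf : IsProfile f) {c : E 3} (hc : ‖c‖ = 1) :
    0 ≤ profileDensity f c := by
  obtain ⟨a, b, h⟩ := exists_isFrame hc
  rw [profileDensity_eq f h]
  exact hf.sectionDensity_nonneg h

theorem profileDensity_neg (hf : IsProfile f) {c : E 3} (hc : ‖c‖ = 1) :
    profileDensity f (-c) = profileDensity f c := by
  obtain ⟨a, b, h⟩ := exists_isFrame hc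
  rw [profileDensity_eq f h, profileDensity_eq f h.neg_right, sectionDensity, sectionDensity]
  have : ∀ z, sectionInt f a b (-c) z = sectionInt f a b c z := by
    intro z
    rw [← hf.sectionInt_neg, sectionInt, sectionInt]
    simp
  simp_rw [this]

theorem continuousOn_profileDensity (hf : IsProfile f) :
    ContinuousOn (profileDensity f) (sphere (0 : E 3) 1) := by
  intro c₀ hc₀
  rw [mem_sphere_zero_iff_norm] at hc₀
  obtain ⟨a, b, h⟩ := exists_isFrame hc₀
  set T : E 3 → E 3 ≃ₗᵢ[ℝ] E 3 := fun c => Submodule.reflection (ℝ ∙ (c + c₀)) with hT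
  have hTc : ∀ c ∈ sphere (0 : E 3) 1, T c c₀ = c := by
    intro c hc
    rw [mem_sphere_zero_iff_norm] at hc
    rw [hT]
    simp only
    rw [Submodule.reflection_singleton_apply]
    rcases eq_or_ne (c + c₀) 0 with h0 | h0
    · rw [h0]
      simp only [inner_zero_left, smul_zero, zero_sub]
      rw [neg_eq_iff_eq_neg, ← add_eq_zero_iff_eq_neg, add_comm, h0]
    · have h1 : ‖c + c₀‖ ^ 2 = 2 * ⟪c + c₀, c₀⟫ := by
        rw [← real_inner_self_eq_norm_sq]
        simp only [inner_add_left, inner_add_right, real_inner_self_eq_norm_sq, hc, hc₀,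
          real_inner_comm c c₀]
        ring
      have h2 : ‖c + c₀‖ ^ 2 ≠ 0 := by positivity
      have h3 : ⟪c + c₀, c₀⟫ / ‖c + c₀‖ ^ 2 = 1 / 2 := by
        rw [div_eq_iff h2, h1]; ring
      simp only [RCLike.ofReal_real_eq_id, id]
      rw [h3]
      module
  have hframe : ∀ c ∈ sphere (0 : E 3) 1, IsFrame (T c a) (T c b) c := by
    intro c hc
    have := h.map (T c)
    rwa [hTc c hc] at this
  have hTcont : ∀ x, ContinuousAt (fun c => T c x) c₀ := by
    intro x
    simp only [hT]
    simp_rw [Submodule.reflection_singleton_apply]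
    have : ‖c₀ + c₀‖ ^ 2 ≠ 0 := by
      rw [← two_smul ℝ c₀, norm_smul, hc₀]; norm_num
    simp only [RCLike.ofReal_real_eq_id, id]
    fun_prop (disch := assumption)
  have hmem : c₀ ∈ sphere (0 : E 3) 1 := by simpa using hc₀
  have key := hf.continuousOn_sectionDensity (T c₀ a, T c₀ b, c₀) (hframe c₀ hmem)
  have hcomp : ContinuousWithinAt (fun c => sectionDensity f (T c a) (T c b) c)
      (sphere (0 : E 3) 1) c₀ := by
    refine ContinuousWithinAt.comp (f := fun c => (T c a, T c b, c))
      (g := fun q : E 3 × E 3 × E 3 => sectionDensity f q.1 q.2.1 q.2.2) key ?_ hframe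
    exact ((hTcont a).prodMk ((hTcont b).prodMk continuousAt_id)).continuousWithinAt
  refine hcomp.congr (fun c hc => profileDensity_eq f (hframe c hc))
    (profileDensity_eq f (hframe c₀ hmem))

/-- Integrals over great circles of the density recover the line integrals of the profile. -/
theorem integral_profileDensity (hf : IsProfile f) {a b u : E 3} (h : IsFrame a b u) :
    ∫ θ in (-π)..π, profileDensity f (cos θ • a + sin θ • b) =
      (∫ s : ℝ, f (s • u)) * ∫ x, invKernel x := by
  obtain ⟨R, hR0, hR⟩ := hf.exists_radius
  obtain ⟨D, hD, hD'⟩ := hf.exists_majorant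
  have hfc := hf.continuous
  set X : ℝ × ℝ → ℝ := fun x => ∫ s : ℝ, f (x.1 • a + x.2 • b + s • u) with hX
  have hXbox : X = fun x => ∫ s in Icc (-R) R, f (x.1 • a + x.2 • b + s • u) := by
    ext x
    refine (setIntegral_eq_integral_of_forall_compl_eq_zero fun s hs => hR _ ?_).symm
    by_contra hle
    obtain ⟨-, -, h3⟩ := h.abs_le_norm x.1 x.2 s
    exact hs (abs_le.1 (h3.trans (not_lt.1 hle)))
  have hXc : Continuous X := by
    rw [hXbox]
    exact continuous_parametric_integral_of_continuous (by fun_prop) isCompact_Icc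
  have hXs : HasCompactSupport X := by
    refine HasCompactSupport.intro (K := Icc (-R) R ×ˢ Icc (-R) R)
      (isCompact_Icc.prod isCompact_Icc) fun x hx => ?_
    refine integral_eq_zero_of_ae (.of_forall fun s => hR _ ?_)
    by_contra hle
    obtain ⟨h1, h2, -⟩ := h.abs_le_norm x.1 x.2 s
    exact hx ⟨abs_le.1 (h1.trans (not_lt.1 hle)), abs_le.1 (h2.trans (not_lt.1 hle))⟩
  have hXe : ∀ x, X (-x) = X x := by
    intro x
    simp only [hX]
    rw [← integral_neg_eq_self]
    congr 1
    ext s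
    rw [← hf.even]
    congr 1
    simp only [Prod.fst_neg, Prod.snd_neg]
    module
  have hline : ∀ θ z, sectionInt f (-sin θ • a + cos θ • b) u (cos θ • a + sin θ • b) z =
      lineInt X θ z := by
    intro θ z
    have hi := hf.integrable_section (h.rotate θ) z
    rw [Measure.volume_eq_prod] at hi
    rw [sectionInt, Measure.volume_eq_prod, integral_prod _ hi, lineInt]
    congr 1
    ext t
    simp only [hX]
    congr 1
    ext s
    congr 1
    module
  have hdens : ∀ θ, profileDensity f (cos θ • a + sin θ • b) =
      ∫ z in Ioi (0 : ℝ), (z ^ 2)⁻¹ * (lineInt X θ 0 - lineInt X θ z) := by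
    intro θ
    rw [profileDensity_eq f (h.rotate θ), sectionDensity]
    simp_rw [hline]
  have hmaj : ∀ θ z, 0 < z → ‖(z ^ 2)⁻¹ * (lineInt X θ 0 - lineInt X θ z)‖ ≤ D z := by
    intro θ z hz
    have := hD' _ _ _ (h.rotate θ) z hz
    rwa [hline, hline] at this
  have hlc := continuous_lineInt hXc hXs
  have hlc0 : Continuous fun q : ℝ × ℝ => lineInt X q.1 0 :=
    hlc.comp (by fun_prop : Continuous fun q : ℝ × ℝ => (q.1, (0 : ℝ)))
  have hdiff : Continuous fun q : ℝ × ℝ => lineInt X q.1 0 - lineInt X q.1 q.2 := hlc0.sub hlc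
  have htr : ∀ ε, 0 < ε → ∀ θ, ∫ z, truncInvSq ε z * (lineInt X θ 0 - lineInt X θ z) =
      ∫ z in Ioi 0, truncInvSq ε z * (lineInt X θ 0 - lineInt X θ z) := by
    intro ε hε θ
    refine (setIntegral_eq_integral_of_forall_compl_eq_zero fun z hz => ?_).symm
    rw [truncInvSq, indicator_of_notMem, zero_mul]
    intro hz'
    exact hz (hε.trans hz')
  have hmaj' : ∀ ε θ z, 0 < z →
      ‖truncInvSq ε z * (lineInt X θ 0 - lineInt X θ z)‖ ≤ D z := by
    intro ε θ z hz
    refine le_trans ?_ (hmaj θ z hz)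
    rw [norm_mul, norm_mul]
    refine mul_le_mul_of_nonneg_right ?_ (norm_nonneg _)
    rw [truncInvSq]
    exact norm_indicator_le_norm_self _ _
  have hinner : ∀ θ, Tendsto (fun ε => ∫ z, truncInvSq ε z * (lineInt X θ 0 - lineInt X θ z))
      (𝓝[>] 0) (𝓝 (profileDensity f (cos θ • a + sin θ • b))) := by
    intro θ
    rw [hdens]
    have hlz : Measurable fun z => lineInt X θ z :=
      (hlc.comp (by fun_prop : Continuous fun z : ℝ => (θ, z))).measurable
    have : Tendsto (fun ε => ∫ z in Ioi 0, truncInvSq ε z * (lineInt X θ 0 - lineInt X θ z))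
        (𝓝[>] 0) (𝓝 (∫ z in Ioi (0 : ℝ), (z ^ 2)⁻¹ * (lineInt X θ 0 - lineInt X θ z))) := by
      refine tendsto_integral_filter_of_dominated_convergence D ?_ ?_ hD ?_
      · refine .of_forall fun ε => Measurable.aestronglyMeasurable ?_
        exact (measurable_truncInvSq ε).mul (hlz.const_sub _)
      · refine .of_forall fun ε => ?_
        filter_upwards [ae_restrict_mem measurableSet_Ioi] with z hz
        exact hmaj' ε θ z hz
      · filter_upwards [ae_restrict_mem measurableSet_Ioi] with z hz
        refine tendsto_const_nhds.congr' ?_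
        filter_upwards [Ioo_mem_nhdsGT (show (0 : ℝ) < z from hz)] with ε hε
        rw [truncInvSq, indicator_of_mem (show z ∈ Ioi ε from hε.2)]
    refine this.congr' ?_
    filter_upwards [self_mem_nhdsWithin] with ε hε
    exact (htr ε hε θ).symm
  have hlim := tendsto_integral_lineInt_sub hXc hXs hXe
  have hX0 : X 0 = ∫ s : ℝ, f (s • u) := by simp [hX]
  rw [hX0] at hlim
  refine tendsto_nhds_unique ?_ hlim
  refine intervalIntegral.tendsto_integral_filter_of_dominated_convergence
    (fun _ => ∫ z in Ioi 0, D z) ?_ ?_ intervalIntegrable_const ?_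
  · refine .of_forall fun ε => ?_
    refine StronglyMeasurable.aestronglyMeasurable ?_
    refine StronglyMeasurable.integral_prod_right'
      (f := fun q : ℝ × ℝ => truncInvSq ε q.2 * (lineInt X q.1 0 - lineInt X q.1 q.2)) ?_
    exact (((measurable_truncInvSq ε).comp measurable_snd).mul hdiff.measurable).stronglyMeasurable
  · filter_upwards [self_mem_nhdsWithin] with ε hε
    refine .of_forall fun θ _ => ?_
    rw [htr ε hε]
    refine norm_integral_le_of_norm_le hD ?_
    filter_upwards [ae_restrict_mem measurableSet_Ioi] with z hz
    exact hmaj' ε θ z hz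
  · exact .of_forall fun θ _ => hinner θ

end IsProfile

section ConvexBody

variable {n : ℕ} {K : Set (E n)}

theorem IsConvexBody.mem_nhds_zero (hK : IsConvexBody K) (hc : IsCentered K) :
    K ∈ 𝓝 (0 : E n) := by
  obtain ⟨-, hconv, x, hx⟩ := hK
  have hneg : -x ∈ interior K := by
    have hKK : Homeomorph.neg (E n) ⁻¹' K = K := by
      ext y
      exact (hc y).symm
    have := (Homeomorph.neg (E n)).preimage_interior K
    rw [hKK] at this
    rw [← this]
    simpa using hx
  have := hconv.interior hx hneg (show (0 : ℝ) ≤ 2⁻¹ by norm_num)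
    (show (0 : ℝ) ≤ 2⁻¹ by norm_num) (by norm_num)
  rw [smul_neg, add_neg_cancel] at this
  exact mem_interior_iff_mem_nhds.1 this

theorem IsConvexBody.gauge_pos (hK : IsConvexBody K) (hc : IsCentered K) {x : E n} (hx : x ≠ 0) :
    0 < gauge K x :=
  (_root_.gauge_pos (absorbent_nhds_zero (hK.mem_nhds_zero hc))
    (NormedSpace.isVonNBounded_of_isBounded ℝ hK.1.isBounded)).2 hx

theorem IsConvexBody.gauge_le_one_iff (hK : IsConvexBody K) (hc : IsCentered K) {x : E n} :
    gauge K x ≤ 1 ↔ x ∈ K := by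
  rw [gauge_le_one_iff_mem_closure hK.2.1 (hK.mem_nhds_zero hc), hK.1.isClosed.closure_eq]

theorem IsConvexBody.radialFn_eq (hK : IsConvexBody K) (hc : IsCentered K) {x : E n}
    (hx : x ≠ 0) : radialFn K x = (gauge K x)⁻¹ := by
  have hpos := hK.gauge_pos hc hx
  have : {c : ℝ | 0 ≤ c ∧ c • x ∈ K} = Icc 0 (gauge K x)⁻¹ := by
    ext c
    refine and_congr_right fun h0 => ?_
    rw [← hK.gauge_le_one_iff hc, gauge_smul_of_nonneg h0, smul_eq_mul, ← one_div,
      le_div_iff₀ hpos]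
  rw [radialFn, this, csSup_Icc (inv_nonneg.2 hpos.le)]

theorem IsConvexBody.contDiffOn_gauge (hK : IsConvexBody K) (hc : IsCentered K)
    (hsm : SmoothOnSphere (radialFn K)) :
    ContDiffOn ℝ (⊤ : ℕ∞) (gauge K) {(0 : E n)}ᶜ := by
  have key : ∀ x ∈ ({(0 : E n)}ᶜ : Set (E n)), ‖x‖⁻¹ • x ≠ 0 := fun x hx =>
    smul_ne_zero (inv_ne_zero (norm_ne_zero_iff.2 hx)) hx
  have h1 : ContDiffOn ℝ (⊤ : ℕ∞) (fun x : E n => ‖x‖ * (radialFn K (‖x‖⁻¹ • x))⁻¹)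
      {(0 : E n)}ᶜ := by
    refine ContDiffOn.mul (fun x hx => (contDiffAt_norm ℝ hx).contDiffWithinAt) (hsm.inv ?_)
    intro x hx
    rw [hK.radialFn_eq hc (key x hx)]
    exact inv_ne_zero (hK.gauge_pos hc (key x hx)).ne'
  refine h1.congr fun x hx => ?_
  rw [hK.radialFn_eq hc (key x hx), inv_inv, gauge_smul_of_nonneg (by positivity), smul_eq_mul,
    mul_inv_cancel_left₀ (norm_ne_zero_iff.2 hx)]

/-- A smooth bump function adapted to the gauge of `K`. -/
def gaugeBump (K : Set (E n)) (x : E n) : ℝ := smoothTransition (2 - 2 * gauge K x)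

theorem IsCentered.gauge_neg (hc : IsCentered K) (x : E n) : gauge K (-x) = gauge K x :=
  _root_.gauge_neg (fun x hx => (hc x).1 hx) x

theorem IsConvexBody.contDiff_gaugeBump (hK : IsConvexBody K) (hc : IsCentered K)
    (hsm : SmoothOnSphere (radialFn K)) : ContDiff ℝ (⊤ : ℕ∞) (gaugeBump K) := by
  rw [contDiff_iff_contDiffAt]
  intro x
  by_cases hx : x = 0
  · have hcont := continuous_gauge hK.2.1 (hK.mem_nhds_zero hc)
    have : ∀ᶠ y in 𝓝 x, gaugeBump K y = 1 := by
      have : ∀ᶠ y in 𝓝 x, gauge K y < 2⁻¹ :=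
        hcont.continuousAt.eventually_lt continuousAt_const (by simp [hx])
      filter_upwards [this] with y hy
      exact smoothTransition.one_of_one_le (by linarith)
    exact contDiffAt_const.congr_of_eventuallyEq this
  · have : ContDiffAt ℝ (⊤ : ℕ∞) (gauge K) x :=
      (hK.contDiffOn_gauge hc hsm).contDiffAt (isOpen_compl_singleton.mem_nhds hx)
    exact smoothTransition.contDiffAt.comp x (contDiffAt_const.sub (contDiffAt_const.mul this))

/-- The integral over the line of the one-dimensional bump. -/
def bumpMass : ℝ := ∫ s : ℝ, smoothTransition (2 - 2 * |s|)

theorem bumpMass_pos : 0 < bumpMass := by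
  have hc : Continuous fun s : ℝ => smoothTransition (2 - 2 * |s|) :=
    smoothTransition.continuous.comp (by fun_prop)
  refine hc.integral_pos_of_hasCompactSupport_nonneg_nonzero ?_
    (fun s => smoothTransition.nonneg _) (x := 0) ?_
  · refine HasCompactSupport.intro (isCompact_Icc (a := -1) (b := 1)) fun s hs => ?_
    refine smoothTransition.zero_of_nonpos ?_
    have : 1 < |s| := by
      rw [← not_le, abs_le]
      exact hs
    linarith
  · exact (smoothTransition.pos_of_pos (by simp)).ne'

theorem IsConvexBody.integral_gaugeBump (hK : IsConvexBody K) (hc : IsCentered K) {u : E n}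
    (hu : u ≠ 0) : ∫ s : ℝ, gaugeBump K (s • u) = radialFn K u * bumpMass := by
  have hpos := hK.gauge_pos hc hu
  have h1 : ∀ s : ℝ, gaugeBump K (s • u) = smoothTransition (2 - 2 * |s * gauge K u|) := by
    intro s
    rw [gaugeBump, abs_mul, abs_of_pos hpos]
    rcases le_total 0 s with h | h
    · rw [gauge_smul_of_nonneg h, abs_of_nonneg h, smul_eq_mul]
    · rw [← hc.gauge_neg, ← neg_smul, gauge_smul_of_nonneg (neg_nonneg.2 h), abs_of_nonpos h,
        smul_eq_mul]
  simp_rw [h1]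
  rw [Measure.integral_comp_mul_right (fun s => smoothTransition (2 - 2 * |s|)),
    abs_of_pos (inv_pos.2 hpos), smul_eq_mul, hK.radialFn_eq hc hu, bumpMass]

end ConvexBody

theorem isProfile_gaugeBump {K : Set (E 3)} (hK : IsConvexBody K) (hc : IsCentered K)
    (hsm : SmoothOnSphere (radialFn K)) : IsProfile (gaugeBump K) where
  contDiff := (hK.contDiff_gaugeBump hc hsm).of_le (WithTop.coe_le_coe.2 le_top)
  compact := by
    refine HasCompactSupport.intro hK.1 fun x hx => ?_
    refine smoothTransition.zero_of_nonpos ?_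
    rw [← hK.gauge_le_one_iff hc, not_le] at hx
    linarith
  nonneg x := smoothTransition.nonneg _
  even x := by rw [gaugeBump, gaugeBump, hc.gauge_neg]
  quasi x y := by
    have h1 : gauge K ((2⁻¹ : ℝ) • (x - y)) ≤ max (gauge K x) (gauge K y) := by
      rw [gauge_smul_of_nonneg (by norm_num), smul_eq_mul, sub_eq_add_neg]
      have := gauge_add_le hK.2.1 (absorbent_nhds_zero (hK.mem_nhds_zero hc)) x (-y)
      rw [hc.gauge_neg] at this
      linarith [le_max_left (gauge K x) (gauge K y), le_max_right (gauge K x) (gauge K y)]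
    rcases le_max_iff.1 h1 with h | h
    · exact min_le_of_left_le (smoothTransition.monotone (by linarith))
    · exact min_le_of_right_le (smoothTransition.monotone (by linarith))

section StarBody

variable {n : ℕ}

/-- The star body with radial function `r` on the unit sphere. -/
def starSet (r : E n → ℝ) : Set (E n) :=
  (fun q : E n × ℝ => (q.2 * r q.1) • q.1) '' (sphere (0 : E n) 1 ×ˢ Icc (0 : ℝ) 1)

variable {r : E n → ℝ}

theorem isCompact_starSet (hr : ContinuousOn r (sphere (0 : E n) 1)) :
    IsCompact (starSet r) := by
  refine ((isCompact_sphere _ _).prod isCompact_Icc).image_of_continuousOn ?_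
  have : ContinuousOn (fun q : E n × ℝ => r q.1) (sphere (0 : E n) 1 ×ˢ Icc (0 : ℝ) 1) :=
    hr.comp continuousOn_fst fun q hq => hq.1
  exact (continuousOn_snd.mul this).smul continuousOn_fst

theorem smul_mem_starSet_iff (hr0 : ∀ v ∈ sphere (0 : E n) 1, 0 ≤ r v) {v : E n} (hv : v ∈ sphere (0 : E n) 1)
    {c : ℝ} (hc : 0 ≤ c) : c • v ∈ starSet r ↔ c ≤ r v := by
  have hv1 : ‖v‖ = 1 := by simpa using hv
  constructor
  · rintro ⟨⟨w, t⟩, ⟨hw, ht0, ht1⟩, h⟩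
    have hw1 : ‖w‖ = 1 := by simpa using hw
    simp only at h ht0 ht1 hw
    have hcn : t * r w = c := by
      have := congrArg norm h
      rwa [norm_smul, norm_smul, hw1, hv1, mul_one, mul_one, norm_of_nonneg hc,
        norm_of_nonneg (mul_nonneg ht0 (hr0 w hw))] at this
    rcases hc.eq_or_lt with rfl | hc'
    · exact hr0 v hv
    · rw [hcn] at h
      rw [← smul_right_injective _ hc'.ne' h, ← hcn]
      exact mul_le_of_le_one_left (hr0 w hw) ht1
  · intro h
    rcases hc.eq_or_lt with rfl | hc'
    · exact ⟨(v, 0), ⟨hv, le_rfl, zero_le_one⟩, by simp⟩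
    · have hpos : 0 < r v := hc'.trans_le h
      refine ⟨(v, c / r v), ⟨hv, by positivity, (div_le_one hpos).2 h⟩, ?_⟩
      simp only
      rw [div_mul_cancel₀ _ hpos.ne']

theorem zero_mem_starSet {v : E n} (hv : v ∈ sphere (0 : E n) 1) : (0 : E n) ∈ starSet r :=
  ⟨(v, 0), ⟨hv, le_rfl, zero_le_one⟩, by simp⟩

theorem starConvex_starSet : StarConvex ℝ 0 (starSet r) := by
  rw [starConvex_zero_iff]
  rintro _ ⟨⟨w, t⟩, ⟨hw, ht0, ht1⟩, rfl⟩ a ha0 ha1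
  refine ⟨(w, a * t), ⟨hw, mul_nonneg ha0 ht0, mul_le_one₀ ha1 ht0 ht1⟩, ?_⟩
  simp only [smul_smul, mul_assoc]

theorem radialFn_starSet (hr0 : ∀ v ∈ sphere (0 : E n) 1, 0 ≤ r v) {v : E n} (hv : v ∈ sphere (0 : E n) 1) :
    radialFn (starSet r) v = r v := by
  have : {c : ℝ | 0 ≤ c ∧ c • v ∈ starSet r} = Icc 0 (r v) := by
    ext c
    exact and_congr_right fun h0 => smul_mem_starSet_iff hr0 hv h0
  rw [radialFn, this, csSup_Icc (hr0 v hv)]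

theorem isStarBody_starSet [NeZero n] (hr : ContinuousOn r (sphere (0 : E n) 1))
    (hr0 : ∀ v ∈ sphere (0 : E n) 1, 0 ≤ r v) : IsStarBody (starSet r) := by
  refine ⟨isCompact_starSet hr, ?_, starConvex_starSet,
    hr.congr fun v hv => radialFn_starSet hr0 hv⟩
  exact zero_mem_starSet (v := EuclideanSpace.single 0 1) (by simp)

end StarBody

theorem IsFrame.circle_mem_sphere {a b c : E 3} (h : IsFrame a b c) (θ : ℝ) :
    cos θ • a + sin θ • b ∈ sphere (0 : E 3) 1 := by
  rw [mem_sphere_zero_iff_norm, ← sq_eq_sq₀ (norm_nonneg _) zero_le_one, h.norm_sq_plane]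
  simp

/-- The area of a central section of a star body in polar coordinates. -/
theorem volume_section_starSet {r : E 3 → ℝ} (hr : ContinuousOn r (sphere (0 : E 3) 1))
    (hr0 : ∀ v ∈ sphere (0 : E 3) 1, 0 ≤ r v) {a b c : E 3} (h : IsFrame a b c) :
    (volume {p : ℝ × ℝ | p.1 • a + p.2 • b ∈ starSet r}).toReal =
      ∫ θ in (-π)..π, r (cos θ • a + sin θ • b) ^ 2 / 2 := by
  set S := {p : ℝ × ℝ | p.1 • a + p.2 • b ∈ starSet r}
  have hS : MeasurableSet S :=
    ((isCompact_starSet hr).isClosed.preimage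
      (f := fun p : ℝ × ℝ => p.1 • a + p.2 • b) (by fun_prop)).measurableSet
  set R : ℝ → ℝ := fun θ => r (cos θ • a + sin θ • b)
  have hR : Continuous R :=
    hr.comp_continuous (by fun_prop) fun θ => h.circle_mem_sphere θ
  have hR0 : ∀ θ, 0 ≤ R θ := fun θ => hr0 _ (h.circle_mem_sphere θ)
  have hmem : ∀ q : ℝ × ℝ, 0 < q.1 → (polarCoord.symm q ∈ S ↔ q.1 ≤ R q.2) := by
    intro q hq
    rw [← smul_mem_starSet_iff hr0 (h.circle_mem_sphere q.2) hq.le]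
    simp only [S, mem_ofPred_eq, polarCoord_symm_apply]
    rw [smul_add, smul_smul, smul_smul]
  set G : ℝ × ℝ → ℝ≥0∞ := {q | q.1 ∈ Ioc 0 (R q.2)}.indicator fun q => ENNReal.ofReal q.1
  have hG : Measurable G := by
    have : MeasurableSet {q : ℝ × ℝ | q.1 ∈ Ioc 0 (R q.2)} :=
      (measurableSet_lt measurable_const measurable_fst).inter
        (measurableSet_le measurable_fst (hR.measurable.comp measurable_snd))
    exact (ENNReal.measurable_ofReal.comp measurable_fst).indicator this
  have h1 : volume S = ∫⁻ θ in Ioo (-π) π, ∫⁻ ρ in Ioi (0 : ℝ),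
      (Ioc 0 (R θ)).indicator (fun ρ => ENNReal.ofReal ρ) ρ := by
    refine Eq.trans ?_ (lintegral_prod_symm' (μ := volume.restrict (Ioi 0))
      (ν := volume.restrict (Ioo (-π) π)) G hG)
    rw [← lintegral_indicator_one hS, ← lintegral_comp_polarCoord_symm, polarCoord_target,
      Measure.prod_restrict]
    refine setLIntegral_congr_fun (measurableSet_Ioi.prod measurableSet_Ioo) ?_
    intro q hq
    have hq0 : 0 < q.1 := hq.1
    have hq' := hmem q hq0
    rw [polarCoord_symm_apply] at hq'
    by_cases hle : q.1 ≤ R q.2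
    · simp [G, hq'.2 hle, hle, hq0]
    · simp [G, mt hq'.1 hle, hle]
  have h2 : ∀ θ, ∫⁻ ρ in Ioi (0 : ℝ), (Ioc 0 (R θ)).indicator (fun ρ => ENNReal.ofReal ρ) ρ =
      ENNReal.ofReal (R θ ^ 2 / 2) := by
    intro θ
    rw [setLIntegral_indicator measurableSet_Ioc, inter_eq_left.2 Ioc_subset_Ioi_self,
      ← ofReal_integral_eq_lintegral_ofReal, ← intervalIntegral.integral_of_le (hR0 θ),
      integral_id]
    · simp
    · exact (continuous_id.integrableOn_Icc).mono_set Ioc_subset_Icc_self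
    · filter_upwards [ae_restrict_mem measurableSet_Ioc] with ρ hρ using hρ.1.le
  simp_rw [h2] at h1
  rw [h1, intervalIntegral.integral_of_le (by linarith [pi_pos]), integral_Ioc_eq_integral_Ioo,
    integral_eq_lintegral_of_nonneg_ae (.of_forall fun θ => by positivity)]
  exact ((hR.pow 2).div_const 2).aestronglyMeasurable

theorem exists_intersection_density {K : Set (E 3)} (hK : IsConvexBody K) (hc : IsCentered K)
    (hsm : SmoothOnSphere (radialFn K)) : ∃ g : E 3 → ℝ,
      ContinuousOn g (sphere (0 : E 3) 1) ∧ (∀ v ∈ sphere (0 : E 3) 1, 0 ≤ g v) ∧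
      (∀ v ∈ sphere (0 : E 3) 1, g (-v) = g v) ∧
      ∀ a b u, IsFrame a b u →
        ∫ θ in (-π)..π, g (cos θ • a + sin θ • b) = radialFn K u := by
  have hf := isProfile_gaugeBump hK hc hsm
  set m : ℝ := bumpMass * ∫ x, invKernel x
  have hm : 0 < m := mul_pos bumpMass_pos integral_invKernel_pos
  refine ⟨fun v => m⁻¹ * profileDensity (gaugeBump K) v,
    hf.continuousOn_profileDensity.const_mul _, fun v hv => ?_, fun v hv => ?_, ?_⟩
  · exact mul_nonneg (inv_nonneg.2 hm.le) (hf.profileDensity_nonneg (by simpa using hv))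
  · simp only
    rw [hf.profileDensity_neg (by simpa using hv)]
  · intro a b u h
    have hu : u ≠ 0 := norm_ne_zero_iff.1 (by rw [h.norm_c]; exact one_ne_zero)
    rw [intervalIntegral.integral_const_mul, hf.integral_profileDensity h,
      hK.integral_gaugeBump hc hu, mul_assoc, mul_left_comm, inv_mul_cancel₀ hm.ne', mul_one]

theorem exists_isIntersectionBodyOf {K : Set (E 3)} {g : E 3 → ℝ}
    (hg : ContinuousOn g (sphere (0 : E 3) 1)) (hg0 : ∀ v ∈ sphere (0 : E 3) 1, 0 ≤ g v)
    (hK : ∀ a b u, IsFrame a b u →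
      ∫ θ in (-π)..π, g (cos θ • a + sin θ • b) = radialFn K u) :
    ∃ M : Set (E 3), IsStarBody M ∧ IsIntersectionBodyOf K M := by
  obtain ⟨k, hk, hsec⟩ := exists_hausdorffMeasure_section
  set r : E 3 → ℝ := fun v => √(2 / k * g v)
  have hr : ContinuousOn r (sphere (0 : E 3) 1) := (hg.const_mul _).sqrt
  have hr0 : ∀ v ∈ sphere (0 : E 3) 1, 0 ≤ r v := fun v _ => sqrt_nonneg _
  refine ⟨starSet r, isStarBody_starSet hr hr0, fun u hu => ?_⟩
  obtain ⟨a, b, h⟩ := exists_isFrame (show ‖u‖ = 1 by simpa using hu)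
  have hdim : ((3 : ℕ) : ℝ) - 1 = 2 := by norm_num
  rw [hdim, hsec a b u h _ (isCompact_starSet hr).isClosed.measurableSet,
    volume_section_starSet hr hr0 h, ← hK a b u h, ← intervalIntegral.integral_const_mul]
  refine intervalIntegral.integral_congr fun θ _ => ?_
  have := hg0 _ (h.circle_mem_sphere θ)
  simp only [r]
  rw [sq_sqrt (by positivity)]
  field_simp

theorem radialFn_eq_integral_hausdorffMeasure {K : Set (E 3)} {g : E 3 → ℝ}
    (hg : ContinuousOn g (sphere (0 : E 3) 1)) (hg0 : ∀ v ∈ sphere (0 : E 3) 1, 0 ≤ g v)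
    (hge : ∀ v ∈ sphere (0 : E 3) 1, g (-v) = g v)
    (hK : ∀ a b u, IsFrame a b u →
      ∫ θ in (-π)..π, g (cos θ • a + sin θ • b) = radialFn K u) :
    ∃ g : E 3 → ℝ, ContinuousOn g (sphere (0 : E 3) 1) ∧
      (∀ v ∈ sphere (0 : E 3) 1, 0 ≤ g v) ∧
      (∀ v ∈ sphere (0 : E 3) 1, g (-v) = g v) ∧
      (∀ u ∈ sphere (0 : E 3) 1,
        radialFn K u = ∫ v in (sphere (0 : E 3) 1 ∩ hyperplane u), g v ∂μH[1]) := by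
  obtain ⟨k, hk, hcirc⟩ := exists_integral_greatCircle
  refine ⟨fun v => k⁻¹ * g v, hg.const_mul _,
    fun v hv => mul_nonneg (inv_nonneg.2 hk.le) (hg0 v hv), fun v hv => by simp only [hge v hv],
    fun u hu => ?_⟩
  obtain ⟨a, b, h⟩ := exists_isFrame (show ‖u‖ = 1 by simpa using hu)
  rw [hcirc a b u h, intervalIntegral.integral_const_mul, mul_inv_cancel_left₀ hk.ne',
    hK a b u h]

end Auxiliary

/-- A centered convex body in `ℝ³` with `C^∞` radial function is the intersection
body of some star body; equivalently, `ρ_K = Rg` for some nonnegative continuous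
even `g` on `S²`. -/
theorem smooth_centered_body_is_intersection_body (K : Set (E 3))
    (hK : IsConvexBody K) (hc : IsCentered K)
    (hsm : SmoothOnSphere (radialFn K)) :
    (∃ M : Set (E 3), IsStarBody M ∧ IsIntersectionBodyOf K M) ∧
    (∃ g : E 3 → ℝ, ContinuousOn g (sphere (0 : E 3) 1) ∧
      (∀ v ∈ sphere (0 : E 3) 1, 0 ≤ g v) ∧
      (∀ v ∈ sphere (0 : E 3) 1, g (-v) = g v) ∧
      (∀ u ∈ sphere (0 : E 3) 1,
        radialFn K u = ∫ v in (sphere (0 : E 3) 1 ∩ hyperplane u), g v ∂μH[1])) := by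
  obtain ⟨g, hg, hg0, hge, hgK⟩ := exists_intersection_density hK hc hsm
  exact ⟨exists_isIntersectionBodyOf hg hg0 hgK,
    radialFn_eq_integral_hausdorffMeasure hg hg0 hge hgK⟩
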